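/- arXiv:2511.06482 — 3 statements merged into one kernel-verified Lean document; each statement's English description precedes it below -/
import Mathlib

section
/- Let e ≥ 4 and 1 ≤ m < n ≤ e−2 be integers with (m,n) ≠ (e−4, e−3) (so that K[\bar S(e,m,n)] is Cohen–Macaulay), and let A = K[\bar S(e,m,n)]/(y, x_{e−1}) with its induced standard grading, a finite-dimensional graded K-algebra. Then the largest degree d with A_d ≠ 0 — which equals the Castelnuovo–Mumford regularity of K[\bar S(e,m,n)] over the polynomial ring R(e,m,n)[y] — is: 6 if (e,m,n) = (4,1,2); 4 if (e,m,n) ∈ {(5,1,2), (5,1,3), (5,2,3)}; 3 if e ≥ 6 and m = 1; 3 if e ≥ 6 and (m,n) ∈ {(2,3), (e−3,e−2), (e−4,e−2)}; 3 if e ≥ 6 and n = e−2 with 2 ≤ m ≤ e−5; and 2 in all remaining cases. -/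
open MvPolynomial

/-- Index set of the polynomial ring `R(e,m,n)`: indices `i ∈ {0,…,e−1} \ {m,n}`. -/
abbrev SallyIdx (e m n : ℕ) : Type := {i : ℕ // i < e ∧ i ≠ m ∧ i ≠ n}

/-- The variable `x_i` of `R(e,m,n)[y]` (and `0` for an invalid index); the extra
variable `y` is `X none`. -/
noncomputable def bX (e m n : ℕ) (i : ℕ) : MvPolynomial (Option (SallyIdx e m n)) ℚ :=
  if h : i < e ∧ i ≠ m ∧ i ≠ n then MvPolynomial.X (some ⟨i, h⟩) else 0

/-- The `ℚ`-algebra homomorphism `R(e,m,n)[y] → ℚ[t₁,t₂]` sending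
`x_i ↦ t₁^{e+i} t₂^{e−1−i}` and `y ↦ t₂^{2e−1}`. -/
noncomputable def barMap (e m n : ℕ) :
    MvPolynomial (Option (SallyIdx e m n)) ℚ →ₐ[ℚ] MvPolynomial (Fin 2) ℚ :=
  MvPolynomial.aeval (fun i : Option (SallyIdx e m n) =>
    match i with
    | none => (MvPolynomial.X 1 : MvPolynomial (Fin 2) ℚ) ^ (2 * e - 1)
    | some j => (MvPolynomial.X 0 : MvPolynomial (Fin 2) ℚ) ^ (e + j.1) *
        (MvPolynomial.X 1 : MvPolynomial (Fin 2) ℚ) ^ (e - 1 - j.1))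

/-- The defining ideal `I_{\bar S(e,m,n)}` of the projective monomial curve. -/
noncomputable def barIdeal (e m n : ℕ) : Ideal (MvPolynomial (Option (SallyIdx e m n)) ℚ) :=
  RingHom.ker (barMap e m n).toRingHom

/-- The ideal `I_{\bar S(e,m,n)} + (y, x_{e−1})` of `R(e,m,n)[y]`. -/
noncomputable def artinIdeal (e m n : ℕ) : Ideal (MvPolynomial (Option (SallyIdx e m n)) ℚ) :=
  barIdeal e m n + Ideal.span {MvPolynomial.X none, bX e m n (e-1)}

/-- The degree-`d` graded piece of `A = K[\bar S(e,m,n)]/(y, x_{e−1})`, realized as the image of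
the space of homogeneous polynomials of degree `d` in `R(e,m,n)[y]/(I_{\bar S(e,m,n)} + (y, x_{e−1}))`. -/
noncomputable def artinPiece (e m n d : ℕ) :
    Submodule ℚ (MvPolynomial (Option (SallyIdx e m n)) ℚ ⧸ artinIdeal e m n) :=
  Submodule.map (Ideal.Quotient.mkₐ ℚ (artinIdeal e m n)).toLinearMap
    (MvPolynomial.homogeneousSubmodule (Option (SallyIdx e m n)) ℚ d)

/-- The exponent vector `(a, b)` of the image `t₁^a t₂^b` of a variable under `barMap`. -/
noncomputable def barExp (e m n : ℕ) : Option (SallyIdx e m n) → (Fin 2 →₀ ℕ)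
  | none => Finsupp.single 1 (2 * e - 1)
  | some j => Finsupp.single 0 (e + j.1) + Finsupp.single 1 (e - 1 - j.1)

/-- `SumReach e m n d a` says that `a` is a sum of at most `d` generators of `S(e,m,n)`. -/
def SumReach (e m n : ℕ) : ℕ → ℕ → Prop
  | 0, a => a = 0
  | d + 1, a => SumReach e m n d a ∨
      ∃ i < e, i ≠ m ∧ i ≠ n ∧ e + i ≤ a ∧ SumReach e m n d (a - (e + i))

/-- The binary number whose bit `a` records whether `SumReach e m n d a` holds. -/
def sumReachMask (e m n : ℕ) : ℕ → ℕ
  | 0 => 1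
  | d + 1 => (List.range e).foldr
      (fun i s => s ||| if i ≠ m ∧ i ≠ n then sumReachMask e m n d <<< (e + i) else 0)
      (sumReachMask e m n d)

lemma testBit_sumReachMask (e m n d a : ℕ) :
    (sumReachMask e m n d).testBit a = true ↔ SumReach e m n d a := by
  induction d generalizing a with
  | zero => simp [sumReachMask, SumReach, Nat.testBit_one_eq_true_iff_self_eq_zero]
  | succ d ih =>
    have key : ∀ l : List ℕ, (l.foldr
        (fun i s => s ||| if i ≠ m ∧ i ≠ n then sumReachMask e m n d <<< (e + i) else 0)
        (sumReachMask e m n d)).testBit a = true ↔ SumReach e m n d a ∨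
          ∃ i ∈ l, i ≠ m ∧ i ≠ n ∧ e + i ≤ a ∧ SumReach e m n d (a - (e + i)) := by
      intro l
      induction l with
      | nil => simp [ih]
      | cons i l ihl =>
        rw [List.foldr_cons, Nat.testBit_or, Bool.or_eq_true, ihl, or_assoc,
          List.exists_mem_cons_iff]
        refine or_congr_right ?_
        split_ifs with hi
        · rw [Nat.testBit_shiftLeft, Bool.and_eq_true, decide_eq_true_eq, ih, or_comm,
            and_iff_right hi.1, and_iff_right hi.2]
        · rw [← and_assoc, Nat.zero_testBit]
          simp only [hi, false_and, false_or, Bool.false_eq_true, or_false]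
    simpa [sumReachMask, SumReach] using key (List.range e)

instance SumReach.decidable (e m n d a : ℕ) : Decidable (SumReach e m n d a) :=
  decidable_of_iff _ (testBit_sumReachMask e m n d a)

section Bridge

variable {e m n : ℕ}

lemma barMap_monomial (c : Option (SallyIdx e m n) →₀ ℕ) (r : ℚ) :
    barMap e m n (monomial c r) = monomial (Finsupp.weight (barExp e m n) c) r := by
  rw [barMap, aeval_monomial, Finsupp.weight_apply, monomial_finsupp_sum_index]
  congr 1
  refine Finsupp.prod_congr fun i _ => ?_
  have h : ∀ k (v : Fin 2 →₀ ℕ), monomial (k • v) (1 : ℚ) = monomial v 1 ^ k := by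
    intro k v; rw [monomial_pow, one_pow]
  rw [h]
  congr 1
  cases i with
  | none => simp [barExp, X_pow_eq_monomial]
  | some j => simp [barExp, X_pow_eq_monomial, monomial_mul]

lemma weight_barExp_add (c : Option (SallyIdx e m n) →₀ ℕ) :
    Finsupp.weight (barExp e m n) c 0 + Finsupp.weight (barExp e m n) c 1
      = c.degree * (2 * e - 1) := by
  induction c using Finsupp.induction_linear with
  | zero => simp
  | add f g hf hg =>
    simp only [map_add, Finsupp.add_apply, add_mul] at *
    omega
  | single i k =>
    cases i with
    | none => simp [Finsupp.weight_single, barExp]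
    | some j =>
      have h := j.2
      simp only [Finsupp.weight_single, barExp, Finsupp.degree_single, smul_add,
        Finsupp.add_apply, Finsupp.smul_apply, Finsupp.single_apply, smul_eq_mul]
      simp only [Fin.isValue, one_ne_zero, zero_ne_one, if_true, if_false, mul_zero, add_zero,
        zero_add, ← mul_add]
      congr 1
      omega

lemma weight_barExp_eq_of_degree_eq {c c' : Option (SallyIdx e m n) →₀ ℕ}
    (hd : c.degree = c'.degree)
    (h : Finsupp.weight (barExp e m n) c 0 = Finsupp.weight (barExp e m n) c' 0) :
    Finsupp.weight (barExp e m n) c = Finsupp.weight (barExp e m n) c' := by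
  have h1 := weight_barExp_add c
  have h2 := weight_barExp_add c'
  rw [← hd] at h2
  ext i
  fin_cases i
  · exact h
  · change Finsupp.weight (barExp e m n) c 1 = Finsupp.weight (barExp e m n) c' 1
    omega

lemma exists_single_add_of_degree_succ {σ : Type*} {d : ℕ} {c : σ →₀ ℕ}
    (hc : c.degree = d + 1) :
    ∃ i c', c = Finsupp.single i 1 + c' ∧ c'.degree = d := by
  have h0 : c ≠ 0 := by rintro rfl; simp at hc
  obtain ⟨i, hi⟩ := Finsupp.ne_iff.mp h0
  have hle : Finsupp.single i 1 ≤ c := by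
    rw [Finsupp.single_le_iff]
    exact Nat.one_le_iff_ne_zero.mpr hi
  refine ⟨i, c - Finsupp.single i 1, (add_tsub_cancel_of_le hle).symm, ?_⟩
  have := congrArg Finsupp.degree (add_tsub_cancel_of_le hle)
  rw [map_add, Finsupp.degree_single] at this
  omega

lemma sumReach_iff (d a : ℕ) : SumReach e m n d a ↔
    ∃ c : Option (SallyIdx e m n) →₀ ℕ, c.degree = d ∧
      Finsupp.weight (barExp e m n) c 0 = a := by
  induction d generalizing a with
  | zero =>
    constructor
    · intro h
      exact ⟨0, by simp, by simpa using (show a = 0 from h).symm⟩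
    · rintro ⟨c, hc, rfl⟩
      rw [Finsupp.degree_eq_zero_iff] at hc
      subst hc
      simp [SumReach]
  | succ d ih =>
    constructor
    · rintro (h | ⟨i, hi, him, hin, hia, h⟩)
      · obtain ⟨c, hc, rfl⟩ := (ih _).mp h
        refine ⟨Finsupp.single none 1 + c, ?_, ?_⟩
        · rw [map_add, Finsupp.degree_single, hc, add_comm]
        · simp [barExp, Finsupp.weight_single]
      · obtain ⟨c, hc, hw⟩ := (ih _).mp h
        refine ⟨Finsupp.single (some ⟨i, hi, him, hin⟩) 1 + c, ?_, ?_⟩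
        · rw [map_add, Finsupp.degree_single, hc, add_comm]
        · simp [barExp, Finsupp.weight_single, hw]
          omega
    · rintro ⟨c, hc, rfl⟩
      obtain ⟨i, c', rfl, hc'⟩ := exists_single_add_of_degree_succ hc
      have h := (ih _).mpr ⟨c', hc', rfl⟩
      cases i with
      | none =>
        left
        simpa [barExp, Finsupp.weight_single] using h
      | some j =>
        right
        refine ⟨j.1, j.2.1, j.2.2.1, j.2.2.2, ?_, ?_⟩
        · simp [barExp, Finsupp.weight_single]
        · simpa [barExp, Finsupp.weight_single] using h

lemma artinPiece_eq_bot_iff (d : ℕ) : artinPiece e m n d = ⊥ ↔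
    ∀ c : Option (SallyIdx e m n) →₀ ℕ, c.degree = d → monomial c (1 : ℚ) ∈ artinIdeal e m n := by
  rw [artinPiece, ← le_bot_iff, Submodule.map_le_iff_le_comap]
  constructor
  · intro h c hc
    have := h ((mem_homogeneousSubmodule d _).mpr (isHomogeneous_monomial (1 : ℚ) hc))
    exact Ideal.Quotient.eq_zero_iff_mem.mp this
  · intro h p hp
    refine Ideal.Quotient.eq_zero_iff_mem.mpr ?_
    rw [p.as_sum]
    refine Ideal.sum_mem _ fun c hc => ?_
    have hd : c.degree = d := by
      by_contra hne
      exact mem_support_iff.mp hc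
        (((mem_homogeneousSubmodule d p).mp hp).coeff_eq_zero hne)
    have := Ideal.mul_mem_left (artinIdeal e m n) (C (coeff c p)) (h c hd)
    rwa [C_mul_monomial, mul_one] at this

lemma monomial_mem_artinIdeal_of_weight_eq {c c' : Option (SallyIdx e m n) →₀ ℕ}
    (hd : c.degree = c'.degree)
    (hw : Finsupp.weight (barExp e m n) c 0 = Finsupp.weight (barExp e m n) c' 0)
    (h : monomial c' (1 : ℚ) ∈ artinIdeal e m n) :
    monomial c (1 : ℚ) ∈ artinIdeal e m n := by
  have hk : monomial c (1 : ℚ) - monomial c' 1 ∈ barIdeal e m n := by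
    rw [barIdeal, RingHom.mem_ker]
    change barMap e m n _ = 0
    rw [map_sub, barMap_monomial, barMap_monomial, weight_barExp_eq_of_degree_eq hd hw, sub_self]
  have := Ideal.add_mem _ (Submodule.mem_sup_left (T := Ideal.span _) hk : _ ∈ artinIdeal e m n) h
  rwa [sub_add_cancel] at this

lemma monomial_single_add_mem_artinIdeal {i : Option (SallyIdx e m n)}
    (hi : (X i : MvPolynomial _ ℚ) ∈ artinIdeal e m n) (c : Option (SallyIdx e m n) →₀ ℕ) :
    monomial (Finsupp.single i 1 + c) (1 : ℚ) ∈ artinIdeal e m n := by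
  have := Ideal.mul_mem_right (monomial c 1) _ hi
  rwa [X, monomial_mul, mul_one] at this

lemma bX_eq_X {i : ℕ} (h : i < e ∧ i ≠ m ∧ i ≠ n) : bX e m n i = X (some ⟨i, h⟩) := dif_pos h

lemma artinPiece_succ_eq_bot {d : ℕ} (h : artinPiece e m n d = ⊥) :
    artinPiece e m n (d + 1) = ⊥ := by
  rw [artinPiece_eq_bot_iff] at h ⊢
  intro c hc
  obtain ⟨i, c', rfl, hc'⟩ := exists_single_add_of_degree_succ hc
  have := Ideal.mul_mem_left _ (monomial (Finsupp.single i 1) 1) (h c' hc')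
  rwa [monomial_mul, mul_one] at this

lemma artinPiece_eq_bot_of_forall_sumReach (htop : e - 1 < e ∧ e - 1 ≠ m ∧ e - 1 ≠ n) {d : ℕ}
    (h : ∀ a, SumReach e m n (d + 1) a →
      SumReach e m n d a ∨ (2 * e - 1 ≤ a ∧ SumReach e m n d (a - (2 * e - 1)))) :
    ∀ d', d < d' → artinPiece e m n d' = ⊥ := by
  intro d' hd'
  induction d', (show d + 1 ≤ d' from hd') using Nat.le_induction with
  | succ k hk ih => exact artinPiece_succ_eq_bot (ih hk)
  | base =>
    rw [artinPiece_eq_bot_iff]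
    intro c hc
    have hy : (X none : MvPolynomial (Option (SallyIdx e m n)) ℚ) ∈ artinIdeal e m n :=
      Submodule.mem_sup_right (Ideal.subset_span (by simp))
    have hx : (X (some ⟨e - 1, htop⟩) : MvPolynomial (Option (SallyIdx e m n)) ℚ) ∈
        artinIdeal e m n :=
      Submodule.mem_sup_right (Ideal.subset_span (by simp [bX_eq_X htop]))
    rcases h _ ((sumReach_iff _ _).mpr ⟨c, hc, rfl⟩) with h | ⟨hle, h⟩
    · obtain ⟨c', hc', hw⟩ := (sumReach_iff _ _).mp h
      refine monomial_mem_artinIdeal_of_weight_eq ?_ ?_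
        (monomial_single_add_mem_artinIdeal hy c')
      · rw [map_add, Finsupp.degree_single, hc, hc', add_comm]
      · simp [barExp, Finsupp.weight_single, hw]
    · obtain ⟨c', hc', hw⟩ := (sumReach_iff _ _).mp h
      refine monomial_mem_artinIdeal_of_weight_eq ?_ ?_
        (monomial_single_add_mem_artinIdeal hx c')
      · rw [map_add, Finsupp.degree_single, hc, hc', add_comm]
      · simp [barExp, Finsupp.weight_single, hw]
        omega

lemma exists_weight_eq_of_coeff_barMap_ne_zero {s : Fin 2 →₀ ℕ}
    {p : MvPolynomial (Option (SallyIdx e m n)) ℚ} (h : coeff s (barMap e m n p) ≠ 0) :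
    ∃ c : Option (SallyIdx e m n) →₀ ℕ, Finsupp.weight (barExp e m n) c = s := by
  rw [p.as_sum, map_sum, coeff_sum] at h
  obtain ⟨c, _, hc⟩ := Finset.exists_ne_zero_of_sum_ne_zero h
  rw [barMap_monomial, coeff_monomial] at hc
  exact ⟨c, by_contra fun hne => hc (if_neg hne)⟩

lemma artinPiece_ne_bot_of_sumReach (htop : e - 1 < e ∧ e - 1 ≠ m ∧ e - 1 ≠ n) {d a : ℕ}
    (h : SumReach e m n (d + 1) a) (h₀ : ¬ SumReach e m n d a)
    (h₁ : ¬ (2 * e - 1 ≤ a ∧ SumReach e m n d (a - (2 * e - 1)))) :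
    artinPiece e m n (d + 1) ≠ ⊥ := by
  rw [Ne, artinPiece_eq_bot_iff]
  intro hbot
  obtain ⟨c, hc, rfl⟩ := (sumReach_iff _ _).mp h
  obtain ⟨p, hp, q, hq, hpq⟩ := Submodule.mem_sup.mp (hbot c hc)
  obtain ⟨α, β, rfl⟩ := Ideal.mem_span_pair.mp hq
  have hp0 : barMap e m n p = 0 := hp
  set V := Finsupp.weight (barExp e m n) c with hV
  have reach : ∀ (i : Option (SallyIdx e m n)) (r : MvPolynomial (Option (SallyIdx e m n)) ℚ),
      coeff V (barMap e m n (r * X i)) ≠ 0 →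
        barExp e m n i 0 ≤ V 0 ∧ SumReach e m n d (V 0 - barExp e m n i 0) := by
    intro i r hr
    rw [map_mul, X, barMap_monomial, coeff_mul_monomial', mul_one] at hr
    simp only [Finsupp.weight_single, one_smul] at hr
    obtain ⟨hle, hne⟩ := ite_ne_right_iff.mp hr
    obtain ⟨c', hc'⟩ := exists_weight_eq_of_coeff_barMap_ne_zero hne
    refine ⟨hle 0, (sumReach_iff _ _).mpr ⟨c', ?_, by rw [hc']; rfl⟩⟩
    have h1 := weight_barExp_add c
    have h2 := weight_barExp_add (Finsupp.single i 1 + c')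
    have h3 : Finsupp.weight (barExp e m n) (Finsupp.single i 1 + c') = V := by
      rw [map_add, hc', Finsupp.weight_single, one_smul, add_tsub_cancel_of_le hle]
    rw [h3, hV, h1] at h2
    have h4 := Nat.eq_of_mul_eq_mul_right (by omega) h2
    rw [map_add, Finsupp.degree_single] at h4
    omega
  have h1 : coeff V (barMap e m n (monomial c 1)) = 1 := by
    rw [barMap_monomial, ← hV, coeff_monomial, if_pos rfl]
  rw [← hpq, map_add, hp0, zero_add, map_add, coeff_add, bX_eq_X htop] at h1
  by_cases hα : coeff V (barMap e m n (α * X none)) = 0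
  · rw [hα, zero_add] at h1
    have := reach (some ⟨e - 1, htop⟩) β (by rw [h1]; exact one_ne_zero)
    have h2 : barExp e m n (some ⟨e - 1, htop⟩) 0 = 2 * e - 1 := by
      simp [barExp]; omega
    rw [h2] at this
    exact h₁ this
  · have := reach none α hα
    simp [barExp] at this
    exact h₀ this

end Bridge

section SumReach

variable {e m n : ℕ}

lemma SumReach.add {d a i : ℕ} (hi : i < e ∧ i ≠ m ∧ i ≠ n) (h : SumReach e m n d a) :
    SumReach e m n (d + 1) (a + (e + i)) :=
  Or.inr ⟨i, hi.1, hi.2.1, hi.2.2, Nat.le_add_left _ _, by rwa [Nat.add_sub_cancel]⟩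

lemma SumReach.succ_cases {d a : ℕ} (h : SumReach e m n (d + 1) a) :
    SumReach e m n d a ∨ (2 * e - 1 ≤ a ∧ SumReach e m n d (a - (2 * e - 1))) ∨
      ((d + 1) * e ≤ a ∧ a ≤ (d + 1) * (2 * e - 2)) := by
  induction d generalizing a with
  | zero =>
    rcases h with h | ⟨i, hi, him, hin, hia, h⟩
    · exact Or.inl h
    · by_cases hie : i = e - 1
      · rw [show e + i = 2 * e - 1 by omega] at hia h
        exact Or.inr (Or.inl ⟨hia, h⟩)
      · simp only [SumReach] at h
        right; right
        omega
  | succ d ih =>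
    rcases h with h | ⟨i, hi, him, hin, hia, h⟩
    · exact Or.inl h
    obtain ⟨b, rfl⟩ := Nat.exists_eq_add_of_le' hia
    rw [Nat.add_sub_cancel] at h
    by_cases hie : i = e - 1
    · rw [show e + i = 2 * e - 1 by omega] at hia ⊢
      exact Or.inr (Or.inl ⟨hia, by rwa [Nat.add_sub_cancel]⟩)
    rcases ih h with h | ⟨hb, h⟩ | ⟨h, h'⟩
    · exact Or.inl (h.add ⟨hi, him, hin⟩)
    · refine Or.inr (Or.inl ⟨by omega, ?_⟩)
      rw [show b + (e + i) - (2 * e - 1) = b - (2 * e - 1) + (e + i) by omega]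
      exact h.add ⟨hi, him, hin⟩
    · right; right
      rw [add_mul (d + 1) 1, add_mul (d + 1) 1]
      omega

lemma sumReach_succ_of_forall_Icc {d L H : ℕ}
    (hLH : ∀ a, L ≤ a → a ≤ H → SumReach e m n d a) (hL : L ≤ (d + 1) * e)
    (hH : (d + 1) * (2 * e - 2) ≤ H + (2 * e - 1)) (hlen : L + (2 * e - 2) ≤ H) (a : ℕ)
    (h : SumReach e m n (d + 1) a) :
    SumReach e m n d a ∨ (2 * e - 1 ≤ a ∧ SumReach e m n d (a - (2 * e - 1))) := by
  rcases h.succ_cases with h | h | ⟨h, h'⟩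
  · exact Or.inl h
  · exact Or.inr h
  · by_cases ha : a ≤ H
    · exact Or.inl (hLH a (by omega) ha)
    · exact Or.inr ⟨by omega, hLH _ (by omega) (by omega)⟩

lemma exists_add_eq_of_four_le {v : ℕ} (h4 : 4 ≤ v) (hv : v + 6 ≤ 2 * e) :
    ∃ i j, (i < e ∧ i ≠ m ∧ i ≠ n) ∧ (j < e ∧ j ≠ m ∧ j ≠ n) ∧ i + j = v := by
  by_contra! h
  rcases lt_or_ge v e with hve | hve
  · have h0 := h 0 v
    have h1 := h 1 (v - 1)
    have h2 := h 2 (v - 2)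
    omega
  · have h0 := h (e - 1) (v - (e - 1))
    have h1 := h (e - 2) (v - (e - 2))
    have h2 := h (e - 3) (v - (e - 3))
    omega

lemma exists_add_eq_of_two_le (hm : 2 ≤ m) (hmn : m < n) (hn : n + 3 ≤ e)
    (h23 : ¬ (m = 2 ∧ n = 3)) (h43 : ¬ (m + 4 = e ∧ n + 3 = e)) {v : ℕ} (hv : v + 2 ≤ 2 * e) :
    ∃ i j, (i < e ∧ i ≠ m ∧ i ≠ n) ∧ (j < e ∧ j ≠ m ∧ j ≠ n) ∧ i + j = v := by
  by_cases h : 4 ≤ v ∧ v + 6 ≤ 2 * e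
  · exact exists_add_eq_of_four_le h.1 h.2
  by_contra! H
  rcases lt_or_ge v e with hve | hve
  · have h0 := H 0 v
    have h1 := H 1 (v - 1)
    omega
  · have h0 := H (e - 1) (v - (e - 1))
    have h1 := H (e - 2) (v - (e - 2))
    omega

lemma sumReach_two_of_add {i j : ℕ} (hi : i < e ∧ i ≠ m ∧ i ≠ n) (hj : j < e ∧ j ≠ m ∧ j ≠ n) :
    SumReach e m n 2 (2 * e + (i + j)) := by
  have := SumReach.add hj (SumReach.add hi (show SumReach e m n 0 0 from rfl))
  convert this using 1
  ring

lemma sumReach_two_of_mem_Icc (hm : 2 ≤ m) (hmn : m < n) (hn : n + 3 ≤ e)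
    (h23 : ¬ (m = 2 ∧ n = 3)) (h43 : ¬ (m + 4 = e ∧ n + 3 = e)) (a : ℕ)
    (ha : 2 * e ≤ a) (ha' : a ≤ 4 * e - 2) : SumReach e m n 2 a := by
  obtain ⟨i, j, hi, hj, hij⟩ :=
    exists_add_eq_of_two_le hm hmn hn h23 h43 (v := a - 2 * e) (by omega)
  have := sumReach_two_of_add hi hj
  rwa [hij, Nat.add_sub_cancel' ha] at this

lemma sumReach_three_of_mem_Icc (he : 9 ≤ e) (hm : 1 ≤ m) (hmn : m < n) (hn : n + 2 ≤ e) (a : ℕ)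
    (ha : 3 * e + 4 ≤ a) (ha' : a ≤ 6 * e - 7) : SumReach e m n 3 a := by
  by_cases h : a + 6 ≤ 5 * e
  · obtain ⟨i, j, hi, hj, hij⟩ :=
      exists_add_eq_of_four_le (e := e) (m := m) (n := n) (v := a - 3 * e) (by omega) (by omega)
    have := (sumReach_two_of_add hi hj).add (i := 0) (by omega)
    convert this using 1
    omega
  · obtain ⟨i, j, hi, hj, hij⟩ :=
      exists_add_eq_of_four_le (e := e) (m := m) (n := n) (v := a - (4 * e - 1))
        (by omega) (by omega)
    have := (sumReach_two_of_add hi hj).add (i := e - 1) (by omega)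
    convert this using 1
    omega

lemma sumReach_one_iff {a : ℕ} :
    SumReach e m n 1 a ↔ a = 0 ∨ ∃ i, (i < e ∧ i ≠ m ∧ i ≠ n) ∧ a = e + i := by
  constructor
  · rintro (h | ⟨i, hi, him, hin, hia, h⟩)
    · exact Or.inl h
    · simp only [SumReach] at h
      exact Or.inr ⟨i, ⟨hi, him, hin⟩, by omega⟩
  · rintro (rfl | ⟨i, hi, rfl⟩)
    · exact Or.inl rfl
    · have := SumReach.add hi (show SumReach e m n 0 0 from rfl)
      simpa only [zero_add] using this

lemma sumReach_two_cases {a : ℕ} (h : SumReach e m n 2 a) :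
    SumReach e m n 1 a ∨
      ∃ i j, (i < e ∧ i ≠ m ∧ i ≠ n) ∧ (j < e ∧ j ≠ m ∧ j ≠ n) ∧ a = 2 * e + (i + j) := by
  rcases h with h | ⟨i, hi, him, hin, hia, h⟩
  · exact Or.inl h
  · rcases sumReach_one_iff.mp h with h | ⟨j, hj, h⟩
    · exact Or.inl (sumReach_one_iff.mpr (Or.inr ⟨i, ⟨hi, him, hin⟩, by omega⟩))
    · exact Or.inr ⟨i, j, ⟨hi, him, hin⟩, hj, by omega⟩

end SumReach

/-- The degree `d + 1` is the largest one supporting a nonzero Apéry-type element of `S(e,m,n)`;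
the quantifiers are bounded so that the condition is decidable. -/
def IsTopDegree (e m n d : ℕ) : Prop :=
  (∃ a < (d + 1) * (2 * e - 1), SumReach e m n (d + 1) a ∧ ¬ SumReach e m n d a ∧
    ¬ (2 * e - 1 ≤ a ∧ SumReach e m n d (a - (2 * e - 1)))) ∧
  ∀ a < (d + 2) * (2 * e - 2) + 1, SumReach e m n (d + 2) a →
    SumReach e m n (d + 1) a ∨ (2 * e - 1 ≤ a ∧ SumReach e m n (d + 1) (a - (2 * e - 1)))

instance (e m n d : ℕ) : Decidable (IsTopDegree e m n d) :=
  inferInstanceAs (Decidable (_ ∧ _))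

lemma IsTopDegree.isGreatest_artinPiece {e m n d : ℕ} (htop : e - 1 < e ∧ e - 1 ≠ m ∧ e - 1 ≠ n)
    (h : IsTopDegree e m n d) :
    artinPiece e m n (d + 1) ≠ ⊥ ∧ ∀ d', d + 1 < d' → artinPiece e m n d' = ⊥ := by
  obtain ⟨⟨a, -, ha, h₀, h₁⟩, hvan⟩ := h
  refine ⟨artinPiece_ne_bot_of_sumReach htop ha h₀ h₁,
    artinPiece_eq_bot_of_forall_sumReach htop fun a ha => ?_⟩
  rcases ha.succ_cases with h | h | ⟨-, h⟩
  · exact Or.inl h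
  · exact Or.inr h
  · exact hvan a (Nat.lt_succ_of_le h) ha

lemma isTopDegree_one {e m n : ℕ} (hm : 2 ≤ m) (hmn : m < n) (hn : n + 3 ≤ e)
    (h23 : ¬ (m = 2 ∧ n = 3)) (h43 : ¬ (m + 4 = e ∧ n + 3 = e)) : IsTopDegree e m n 1 := by
  refine ⟨⟨2 * e, by omega, ?_, ?_, ?_⟩, fun a _ => ?_⟩
  · exact sumReach_two_of_add (i := 0) (j := 0) (by omega) (by omega)
  · rw [sumReach_one_iff]
    rintro (h | ⟨i, hi, h⟩) <;> omega
  · rw [sumReach_one_iff]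
    rintro ⟨-, h | ⟨i, hi, h⟩⟩ <;> omega
  · exact sumReach_succ_of_forall_Icc (sumReach_two_of_mem_Icc hm hmn hn h23 h43)
      (by omega) (by omega) (by omega) a

lemma isTopDegree_two {e m n : ℕ} (he : 9 ≤ e) (hm : 1 ≤ m) (hmn : m < n) (hn : n + 2 ≤ e)
    (h : m = 1 ∨ (m = 2 ∧ n = 3) ∨ n + 2 = e) : IsTopDegree e m n 2 := by
  refine ⟨?_, fun a _ => sumReach_succ_of_forall_Icc
    (sumReach_three_of_mem_Icc he hm hmn hn) (by omega) (by omega) (by omega) a⟩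
  have key : ∀ v, 4 ≤ v → v + 6 ≤ 2 * e →
      (∀ i j, (i < e ∧ i ≠ m ∧ i ≠ n) → (j < e ∧ j ≠ m ∧ j ≠ n) →
        3 * e + v ≠ 2 * e + (i + j) ∧ e + v + 1 ≠ e + i ∧ e + v + 1 ≠ 2 * e + (i + j)) →
      ∃ a < (2 + 1) * (2 * e - 1), SumReach e m n (2 + 1) a ∧ ¬ SumReach e m n 2 a ∧
        ¬ (2 * e - 1 ≤ a ∧ SumReach e m n 2 (a - (2 * e - 1))) := by
    intro v hv4 hv hne
    obtain ⟨i, j, hi, hj, hij⟩ := exists_add_eq_of_four_le (m := m) (n := n) hv4 hv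
    have hreach := (sumReach_two_of_add hi hj).add (i := 0) (by omega)
    rw [hij, show 2 * e + v + (e + 0) = 3 * e + v by ring] at hreach
    refine ⟨3 * e + v, by omega, hreach, fun h => ?_, fun ⟨_, h⟩ => ?_⟩
    · rcases sumReach_two_cases h with h | ⟨i, j, hi, hj, h⟩
      · rcases sumReach_one_iff.mp h with h | ⟨i, hi, h⟩ <;> omega
      · exact (hne i j hi hj).1 h
    · rw [show 3 * e + v - (2 * e - 1) = e + v + 1 by omega] at h
      rcases sumReach_two_cases h with h | ⟨i, j, hi, hj, h⟩
      · rcases sumReach_one_iff.mp h with h | ⟨i, hi, h⟩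
        · omega
        · exact (hne i i hi hi).2.1 h
      · exact (hne i j hi hj).2.2 h
  rcases h with rfl | ⟨rfl, rfl⟩ | hne
  · exact key e (by omega) (by omega) (by omega)
  · exact key (e + 2) (by omega) (by omega) (by omega)
  · exact key (e - 3) (by omega) (by omega) (by omega)

lemma isTopDegree_of_lt_nine {e m n : ℕ} (he9 : e < 9) (he : 4 ≤ e) (hm : 1 ≤ m) (hmn : m < n)
    (hn : n ≤ e - 2) (hmn' : (m, n) ≠ (e - 4, e - 3)) : IsTopDegree e m n
      ((if (e, m, n) = (4, 1, 2) then 6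
        else if (e, m, n) = (5, 1, 2) ∨ (e, m, n) = (5, 1, 3) ∨ (e, m, n) = (5, 2, 3) then 4
        else if 6 ≤ e ∧ (m = 1 ∨ (m, n) = (2, 3) ∨ (m, n) = (e - 3, e - 2) ∨
            (m, n) = (e - 4, e - 2) ∨ (n = e - 2 ∧ 2 ≤ m ∧ m ≤ e - 5)) then 3
        else 2) - 1) := by
  have hm6 : m ≤ 5 := by omega
  have hn6 : n ≤ 6 := by omega
  interval_cases e <;> interval_cases m <;> interval_cases n <;>
    first
    | exact absurd rfl hmn'
    | exact absurd hn (by decide)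
    | decide +kernel

theorem stmt16 (e m n : ℕ) (he : 4 ≤ e) (hm : 1 ≤ m) (hmn : m < n) (hn : n ≤ e - 2)
    (hmn' : (m, n) ≠ (e - 4, e - 3)) :
    ∀ r : ℕ,
      r = (if (e, m, n) = (4, 1, 2) then 6
           else if (e, m, n) = (5, 1, 2) ∨ (e, m, n) = (5, 1, 3) ∨ (e, m, n) = (5, 2, 3) then 4
           else if 6 ≤ e ∧ (m = 1 ∨ (m, n) = (2, 3) ∨ (m, n) = (e - 3, e - 2) ∨
               (m, n) = (e - 4, e - 2) ∨ (n = e - 2 ∧ 2 ≤ m ∧ m ≤ e - 5)) then 3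
           else 2) →
      artinPiece e m n r ≠ ⊥ ∧ ∀ d : ℕ, r < d → artinPiece e m n d = ⊥ := by
  intro r hr
  suffices h : IsTopDegree e m n (r - 1) by
    have hr0 : r - 1 + 1 = r := Nat.sub_add_cancel (by rw [hr]; split_ifs <;> norm_num)
    rw [← hr0]
    exact h.isGreatest_artinPiece (by omega)
  rcases lt_or_ge e 9 with he9 | he9
  · rw [hr]
    exact isTopDegree_of_lt_nine he9 he hm hmn hn hmn'
  simp only [ne_eq, Prod.mk.injEq] at hr hmn'
  rw [if_neg (by omega), if_neg (by omega)] at hr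
  split_ifs at hr with h <;> subst hr
  · exact isTopDegree_two he9 hm hmn (by omega) (by omega)
  · exact isTopDegree_one (by omega) hmn (by omega) (by omega) (by omega)
end

section
/- Let e ≥ 10 and 2 ≤ n ≤ e−2 be integers, and equip R(e,1,n) with the graded reverse lexicographic monomial order in which x_i > x_j whenever i < j (so x_0 is the largest and x_{e−1} the smallest variable). Let 𝒢 = G ∪ G', where G is the minimal generating set of I_{S(e,1,n)} (given by J_n ∪ K_n ∪ L_{e,n} as described in the context) and G' is: ∅ if n ∈ {2, 3, e−2}; {x_0 x_5 x_{e−2} − x_2^2 x_{e−1}, x_2^2 x_{e−2} − x_0 x_3 x_{e−1}} if n = 4; {x_0 x_{n+1} x_{e−2} − x_2 x_{n−2} x_{e−1}} if 5 ≤ n ≤ e−4; and {x_{e−2}^3 − x_{e−4} x_{e−1}^2, x_2 x_{e−2}^2 − x_0 x_{e−1}^2, x_0 x_{e−2}^2 − x_2 x_{e−5} x_{e−1}} if n = e−3. Then 𝒢 is a Gröbner basis of I_{S(e,1,n)}: the monomial ideal generated by the leading monomials of the elements of 𝒢 equals the ideal generated by the leading monomials of all nonzero elements of I_{S(e,1,n)}.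 -/
open MvPolynomial

/-- The variable `x_i` of `R(e,m,n)` (and `0` for an invalid index). -/
noncomputable def sX (e m n : ℕ) (i : ℕ) : MvPolynomial (SallyIdx e m n) ℚ :=
  if h : i < e ∧ i ≠ m ∧ i ≠ n then MvPolynomial.X ⟨i, h⟩ else 0

/-- The defining toric ideal `I_{S(e,m,n)}`: the kernel of the `ℚ`-algebra homomorphism
`R(e,m,n) → ℚ[t]` sending `x_i ↦ t^{e+i}`. -/
noncomputable def sallyIdeal (e m n : ℕ) : Ideal (MvPolynomial (SallyIdx e m n) ℚ) :=
  RingHom.ker (MvPolynomial.aeval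
    (fun i : SallyIdx e m n => (Polynomial.X : Polynomial ℚ) ^ (e + i.1))).toRingHom

/-- The strict graded reverse lexicographic order on exponent vectors, where `x_i > x_j`
whenever `i < j`: `a < b` iff `a` has smaller total degree, or the degrees agree and the
rightmost (i.e. largest-index) nonzero entry of `a − b` is positive. -/
def grevlexLT (e m n : ℕ) (a b : SallyIdx e m n →₀ ℕ) : Prop :=
  (a.sum fun _ k => k) < (b.sum fun _ k => k) ∨
  ((a.sum fun _ k => k) = (b.sum fun _ k => k) ∧
    ∃ k : SallyIdx e m n, b k < a k ∧ ∀ j : SallyIdx e m n, k.1 < j.1 → a j = b j)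

/-- `d` is the exponent vector of the leading monomial of `p` for the above grevlex order. -/
def IsLeadExp (e m n : ℕ) (p : MvPolynomial (SallyIdx e m n) ℚ)
    (d : SallyIdx e m n →₀ ℕ) : Prop :=
  d ∈ p.support ∧ ∀ d' ∈ p.support, d' ≠ d → grevlexLT e m n d' d

/-- The set of leading monomials of the nonzero elements of a set `P` of polynomials. -/
noncomputable def lmSet (e m n : ℕ) (P : Set (MvPolynomial (SallyIdx e m n) ℚ)) :
    Set (MvPolynomial (SallyIdx e m n) ℚ) :=
  {q | ∃ p ∈ P, p ≠ 0 ∧ ∃ d, IsLeadExp e m n p d ∧ q = MvPolynomial.monomial d (1 : ℚ)}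

/-- Shorthand for the variables of `R(e,1,n)`. -/
noncomputable def xx (e n i : ℕ) : MvPolynomial (SallyIdx e 1 n) ℚ := sX e 1 n i

/-- The set `𝒢 = G ∪ G' = J_n ∪ K_n ∪ L_{e,n} ∪ G'_{S(e,1,n)}`. -/
noncomputable def gbSet (e n : ℕ) : Set (MvPolynomial (SallyIdx e 1 n) ℚ) :=
  -- J_n : 2×2 minors of A_n
  {p | ∃ i j : ℕ, (2 ≤ i ∧ i ≤ e - 2 ∧ i ≠ n - 1 ∧ i ≠ n) ∧
      (2 ≤ j ∧ j ≤ e - 2 ∧ j ≠ n - 1 ∧ j ≠ n) ∧ i < j ∧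
      p = xx e n i * xx e n (j+1) - xx e n (i+1) * xx e n j} ∪
  {p | ∃ i : ℕ, (2 ≤ i ∧ i ≤ e - 2 ∧ i ≠ n - 1 ∧ i ≠ n) ∧
      p = xx e n 0 ^ 2 * xx e n i - xx e n (i+1) * xx e n (e-1)} ∪
  -- K_n, case n = 2
  {p | n = 2 ∧ ∃ i : ℕ, 3 ≤ i ∧ i ≤ e - 4 ∧
      p = xx e n 0 * xx e n (i+3) - xx e n 3 * xx e n i} ∪
  {p | n = 2 ∧ p = xx e n 0 ^ 3 - xx e n 3 * xx e n (e-3)} ∪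
  -- K_n, case n ≥ 3 (the cubic is omitted when n = e−2)
  {p | 3 ≤ n ∧ ∃ i : ℕ, (2 ≤ i ∧ i ≤ e - 3 ∧ i ≠ n - 2 ∧ i ≠ n) ∧
      p = xx e n 0 * xx e n (i+2) - xx e n 2 * xx e n i} ∪
  {p | 3 ≤ n ∧ n ≤ e - 3 ∧ p = xx e n 0 ^ 3 - xx e n 2 * xx e n (e-2)} ∪
  -- L_{e,3}
  {p | n = 3 ∧ ∃ i : ℕ, i ≤ e - 7 ∧ p = xx e n 4 * xx e n (4+i) - xx e n 2 * xx e n (6+i)} ∪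
  {p | n = 3 ∧ p = xx e n 0 ^ 2 * xx e n 2 - xx e n 4 * xx e n (e-2)} ∪
  -- L_{e,4}
  {p | n = 4 ∧ ∃ i : ℕ, i ≤ e - 8 ∧ p = xx e n 5 * xx e n (5+i) - xx e n 3 * xx e n (7+i)} ∪
  {p | n = 4 ∧ (p = xx e n 3 ^ 2 - xx e n 0 * xx e n 6 ∨
      p = xx e n 0 ^ 2 * xx e n 3 - xx e n 5 * xx e n (e-2) ∨
      p = xx e n 0 * xx e n 2 ^ 2 - xx e n 5 * xx e n (e-1) ∨
      p = xx e n 2 ^ 3 - xx e n 7 * xx e n (e-1))} ∪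
  -- L_{e,n} for 5 ≤ n ≤ e−4
  {p | 5 ≤ n ∧ n ≤ e - 4 ∧ ∃ i : ℕ, i ≤ e - n - 4 ∧
      p = xx e n (n+1) * xx e n (n+1+i) - xx e n (n-1) * xx e n (n+3+i)} ∪
  {p | 5 ≤ n ∧ n ≤ e - 4 ∧ ∃ i : ℕ, i ≤ n - 5 ∧
      p = xx e n (n-1) * xx e n (n-1-i) - xx e n (n+1) * xx e n (n-3-i)} ∪
  {p | 5 ≤ n ∧ n ≤ e - 4 ∧ (p = xx e n (n-1) * xx e n 3 - xx e n (n+2) * xx e n 0 ∨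
      p = xx e n 0 ^ 2 * xx e n (n-1) - xx e n (n+1) * xx e n (e-2) ∨
      p = xx e n 0 * xx e n 2 * xx e n (n-2) - xx e n (n+1) * xx e n (e-1))} ∪
  -- L_{e,e−3}
  {p | n = e - 3 ∧ ∃ i : ℕ, i ≤ e - 8 ∧
      p = xx e n (e-4) * xx e n (e-4-i) - xx e n (e-2) * xx e n (e-6-i)} ∪
  {p | n = e - 3 ∧ (p = xx e n (e-4) * xx e n 3 - xx e n 0 * xx e n (e-1) ∨
      p = xx e n 0 ^ 2 * xx e n (e-4) - xx e n (e-2) ^ 2 ∨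
      p = xx e n 0 * xx e n 2 * xx e n (e-5) - xx e n (e-2) * xx e n (e-1))} ∪
  -- L_{e,e−2}
  {p | n = e - 2 ∧ ∃ i : ℕ, i ≤ e - 7 ∧
      p = xx e n (e-3) * xx e n (e-3-i) - xx e n (e-1) * xx e n (e-5-i)} ∪
  {p | n = e - 2 ∧ (p = xx e n 0 ^ 3 - xx e n 3 * xx e n (e-3) ∨
      p = xx e n 0 * xx e n 2 * xx e n (e-4) - xx e n (e-1) ^ 2)} ∪
  -- G' (empty for n ∈ {2, 3, e−2})
  {p | n = 4 ∧ (p = xx e n 0 * xx e n 5 * xx e n (e-2) - xx e n 2 ^ 2 * xx e n (e-1) ∨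
      p = xx e n 2 ^ 2 * xx e n (e-2) - xx e n 0 * xx e n 3 * xx e n (e-1))} ∪
  {p | 5 ≤ n ∧ n ≤ e - 4 ∧
      p = xx e n 0 * xx e n (n+1) * xx e n (e-2) - xx e n 2 * xx e n (n-2) * xx e n (e-1)} ∪
  {p | n = e - 3 ∧ (p = xx e n (e-2) ^ 3 - xx e n (e-4) * xx e n (e-1) ^ 2 ∨
      p = xx e n 2 * xx e n (e-2) ^ 2 - xx e n 0 * xx e n (e-1) ^ 2 ∨
      p = xx e n 0 * xx e n (e-2) ^ 2 - xx e n 2 * xx e n (e-5) * xx e n (e-1))}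

/-- The exponent vector of the variable `x_i` (and `0` for an invalid index). -/
noncomputable def varExp (e n i : ℕ) : SallyIdx e 1 n →₀ ℕ :=
  if h : i < e ∧ i ≠ 1 ∧ i ≠ n then Finsupp.single ⟨i, h⟩ 1 else 0

/-- The weight of an exponent vector: the exponent of `t` in the image of the monomial. -/
noncomputable def expWeight (e n : ℕ) : (SallyIdx e 1 n →₀ ℕ) →+ ℕ :=
  Finsupp.weight fun i : SallyIdx e 1 n => e + i.1

/-- The monomial with exponent `d` is divisible by a leading monomial of `gbSet`. -/
def IsReducible (e n : ℕ) (d : SallyIdx e 1 n →₀ ℕ) : Prop :=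
  ∃ g ∈ gbSet e n, ∃ l, IsLeadExp e 1 n g l ∧ l ≤ d

section GrevlexOrder

variable {e m n : ℕ}

theorem sum_exp_add (a b : SallyIdx e m n →₀ ℕ) :
    ((a + b).sum fun _ k => k) = (a.sum fun _ k => k) + b.sum fun _ k => k :=
  Finsupp.sum_add_index' (fun _ => rfl) fun _ _ _ => rfl

theorem grevlexLT_irrefl (a : SallyIdx e m n →₀ ℕ) : ¬ grevlexLT e m n a a := by
  rintro (h | ⟨-, k, hk, -⟩) <;> omega

theorem grevlexLT_trans {a b c : SallyIdx e m n →₀ ℕ} (hab : grevlexLT e m n a b)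
    (hbc : grevlexLT e m n b c) : grevlexLT e m n a c := by
  rcases hab with hab | ⟨hab, k, hk, hkj⟩ <;> rcases hbc with hbc | ⟨hbc, l, hl, hlj⟩
  · exact Or.inl (by omega)
  · exact Or.inl (by omega)
  · exact Or.inl (by omega)
  · refine Or.inr ⟨by omega, ?_⟩
    rcases lt_trichotomy k.1 l.1 with h | h | h
    · exact ⟨l, by rw [hkj l h]; exact hl, fun j hj => (hkj j (h.trans hj)).trans (hlj j hj)⟩
    · obtain rfl : k = l := Subtype.ext h
      exact ⟨k, by omega, fun j hj => (hkj j hj).trans (hlj j hj)⟩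
    · exact ⟨k, by rw [← hlj k h]; exact hk, fun j hj => (hkj j hj).trans (hlj j (h.trans hj))⟩

theorem grevlexLT_add_right {a b : SallyIdx e m n →₀ ℕ} (h : grevlexLT e m n a b)
    (c : SallyIdx e m n →₀ ℕ) : grevlexLT e m n (a + c) (b + c) := by
  rcases h with h | ⟨h, k, hk, hkj⟩
  · exact Or.inl (by simp only [sum_exp_add]; omega)
  · refine Or.inr ⟨by simp only [sum_exp_add]; omega, k, ?_, fun j hj => ?_⟩
    · simpa using hk
    · simpa using hkj j hj

instance : IsStrictOrder (SallyIdx e m n →₀ ℕ) (grevlexLT e m n) where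
  irrefl := grevlexLT_irrefl
  trans _ _ _ := grevlexLT_trans

end GrevlexOrder

section ToricIdeal

variable {e n : ℕ}

theorem aeval_sally_apply (p : MvPolynomial (SallyIdx e 1 n) ℚ) :
    MvPolynomial.aeval (fun i : SallyIdx e 1 n => (Polynomial.X : Polynomial ℚ) ^ (e + i.1)) p =
      ∑ d ∈ p.support, Polynomial.monomial (expWeight e n d) (p.coeff d) := by
  rw [MvPolynomial.aeval_def, MvPolynomial.eval₂_eq]
  refine Finset.sum_congr rfl fun d _ => ?_
  rw [← Polynomial.C_mul_X_pow_eq_monomial]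
  congr 1
  simp only [← pow_mul, Finset.prod_pow_eq_pow_sum, expWeight, Finsupp.weight_apply, Finsupp.sum,
    smul_eq_mul, mul_comm]

theorem mem_sallyIdeal_iff (p : MvPolynomial (SallyIdx e 1 n) ℚ) :
    p ∈ sallyIdeal e 1 n ↔
      ∑ d ∈ p.support, Polynomial.monomial (expWeight e n d) (p.coeff d) = 0 := by
  rw [← aeval_sally_apply]
  rfl

theorem exists_grevlexLT_of_isLeadExp {p : MvPolynomial (SallyIdx e 1 n) ℚ}
    (hp : p ∈ sallyIdeal e 1 n) {d : SallyIdx e 1 n →₀ ℕ} (hd : IsLeadExp e 1 n p d) :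
    ∃ d', expWeight e n d' = expWeight e n d ∧ grevlexLT e 1 n d' d := by
  by_contra! h
  rw [mem_sallyIdeal_iff] at hp
  have h1 := congrArg (fun q => Polynomial.coeff q (expWeight e n d)) hp
  simp only [Polynomial.finsetSum_coeff, Polynomial.coeff_monomial, Polynomial.coeff_zero] at h1
  rw [Finset.sum_eq_single_of_mem d hd.1, if_pos rfl] at h1
  · exact (MvPolynomial.mem_support_iff.1 hd.1) h1
  · exact fun d' hd' hne => if_neg fun hw => h d' hw (hd.2 d' hd' hne)

theorem finite_expWeight_eq (w : ℕ) : {d | expWeight e n d = w}.Finite := by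
  have : Finite (SallyIdx e 1 n) :=
    Finite.of_injective (fun i : SallyIdx e 1 n => (⟨i.1, i.2.1⟩ : Fin e)) fun i j h =>
      Subtype.ext (by simpa using h)
  have hinj : Function.Injective fun d : SallyIdx e 1 n →₀ ℕ => (d : SallyIdx e 1 n → ℕ) :=
    DFunLike.coe_injective
  refine Set.Finite.of_finite_image (f := fun d => (d : SallyIdx e 1 n → ℕ)) ?_ hinj.injOn
  refine (Set.Finite.pi' fun _ => Set.finite_Iic w).subset ?_
  rintro _ ⟨d, rfl, rfl⟩ i
  exact Finsupp.le_weight _ (by omega) _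

end ToricIdeal

section NormalForm

variable {e n : ℕ}

theorem IsReducible.of_add_eq {d c d' : SallyIdx e 1 n →₀ ℕ} (h : IsReducible e n d)
    (hd : c + d = d') : IsReducible e n d' := by
  obtain ⟨g, hg, l, hl, hle⟩ := h
  exact ⟨g, hg, l, hl, hle.trans (hd ▸ le_add_self)⟩

theorem IsReducible.monomial_mem {d : SallyIdx e 1 n →₀ ℕ} (h : IsReducible e n d) :
    monomial d (1 : ℚ) ∈ Ideal.span (lmSet e 1 n (gbSet e n)) := by
  obtain ⟨g, hg, l, hl, hle⟩ := h
  obtain ⟨c, rfl⟩ := exists_add_of_le hle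
  have h1 : monomial l (1 : ℚ) ∈ Ideal.span (lmSet e 1 n (gbSet e n)) :=
    Ideal.subset_span ⟨g, hg, fun h0 => by simpa [h0] using hl.1, l, hl, rfl⟩
  simpa [monomial_mul] using Ideal.mul_mem_right (monomial c (1 : ℚ)) _ h1

/-- If irreducible exponents are determined by their weights, then `gbSet` is a Gröbner basis. -/
theorem span_lmSet_eq (hsub : gbSet e n ⊆ sallyIdeal e 1 n)
    (hinj : ∀ d d', ¬ IsReducible e n d → ¬ IsReducible e n d' →
      expWeight e n d = expWeight e n d' → d = d') :
    Ideal.span (lmSet e 1 n (gbSet e n)) =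
      Ideal.span (lmSet e 1 n (sallyIdeal e 1 n : Set (MvPolynomial (SallyIdx e 1 n) ℚ))) := by
  apply le_antisymm
  · refine Ideal.span_mono ?_
    rintro q ⟨p, hp, h⟩
    exact ⟨p, hsub hp, h⟩
  · rw [Ideal.span_le]
    rintro q ⟨p, hp, -, d, hd, rfl⟩
    refine IsReducible.monomial_mem ?_
    by_contra hred
    obtain ⟨m, hm, hmd⟩ := exists_grevlexLT_of_isLeadExp hp hd
    have hwf := (finite_expWeight_eq (e := e) (n := n) (expWeight e n d)).wellFoundedOn
      (r := grevlexLT e 1 n)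
    rw [Set.WellFoundedOn] at hwf
    obtain ⟨⟨m₀, hm₀⟩, -, hmin⟩ := hwf.has_min Set.univ ⟨⟨m, hm⟩, trivial⟩
    have hm₀red : ¬ IsReducible e n m₀ := by
      rintro ⟨g, hg, l, hl, hle⟩
      obtain ⟨c, rfl⟩ := exists_add_of_le hle
      obtain ⟨l', hl', hlt⟩ := exists_grevlexLT_of_isLeadExp (hsub hg) hl
      refine hmin ⟨l' + c, ?_⟩ trivial (grevlexLT_add_right hlt c)
      rw [Set.mem_ofPred_eq, ← hm₀, map_add, map_add, hl']
    obtain rfl := hinj m₀ d hm₀red hred hm₀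
    exact hmin ⟨m, hm⟩ trivial hmd

theorem isReducible_or_exists_eq (β : ℕ → SallyIdx e 1 n →₀ ℕ) (h0 : β 0 = 0) (he : 0 < e)
    (hstep : ∀ r < 2 * e - 1, ∀ i, i < e - 1 → i ≠ 1 → i ≠ n →
      IsReducible e n (varExp e n i + β r) ∨ ∃ r' < 2 * e - 1, varExp e n i + β r = β r')
    (d : SallyIdx e 1 n →₀ ℕ) :
    IsReducible e n d ∨ ∃ a r : ℕ, r < 2 * e - 1 ∧ d = a • varExp e n (e - 1) + β r := by
  classical
  obtain ⟨s, rfl⟩ := Multiset.toFinsupp.surjective d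
  induction s using Multiset.induction_on with
  | empty => exact Or.inr ⟨0, 0, by omega, by simp [h0]⟩
  | cons i s ih =>
    have hi : Multiset.toFinsupp (i ::ₘ s) = varExp e n i.1 + Multiset.toFinsupp s := by
      rw [← Multiset.singleton_add, map_add, Multiset.toFinsupp_singleton, varExp, dif_pos i.2]
    rw [hi]
    rcases ih with h | ⟨a, r, hr, h⟩
    · exact Or.inl (h.of_add_eq rfl)
    · rw [h]
      rcases eq_or_ne i.1 (e - 1) with hie | hie
      · exact Or.inr ⟨a + 1, r, hr, by rw [hie, add_smul, one_smul]; abel⟩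
      · rcases hstep r hr i.1 (by have := i.2.1; omega) i.2.2.1 i.2.2.2 with h' | ⟨r', hr', h'⟩
        · exact Or.inl (h'.of_add_eq (c := a • varExp e n (e - 1)) (by abel))
        · exact Or.inr ⟨a, r', hr', by rw [← h']; abel⟩

theorem expWeight_varExp {i : ℕ} (h : i < e) (h1 : i ≠ 1) (hn : i ≠ n) :
    expWeight e n (varExp e n i) = e + i := by
  rw [varExp, dif_pos ⟨h, h1, hn⟩, expWeight, Finsupp.weight_single, one_smul]

theorem eq_of_expWeight_eq (β : ℕ → SallyIdx e 1 n →₀ ℕ) (h0 : β 0 = 0) (he : 2 < e)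
    (hne : n ≤ e - 2)
    (hstep : ∀ r < 2 * e - 1, ∀ i, i < e - 1 → i ≠ 1 → i ≠ n →
      IsReducible e n (varExp e n i + β r) ∨ ∃ r' < 2 * e - 1, varExp e n i + β r = β r')
    (hβ : ∀ r < 2 * e - 1, ∃ c, expWeight e n (β r) = r + (2 * e - 1) * c)
    (d d' : SallyIdx e 1 n →₀ ℕ) (hd : ¬ IsReducible e n d) (hd' : ¬ IsReducible e n d')
    (h : expWeight e n d = expWeight e n d') : d = d' := by
  obtain ⟨a, r, hr, rfl⟩ :=
    (isReducible_or_exists_eq β h0 (by omega) hstep d).resolve_left hd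
  obtain ⟨a', r', hr', rfl⟩ :=
    (isReducible_or_exists_eq β h0 (by omega) hstep d').resolve_left hd'
  have hy : expWeight e n (varExp e n (e - 1)) = 2 * e - 1 := by
    rw [expWeight_varExp (by omega) (by omega) (by omega)]; omega
  obtain ⟨c, hc⟩ := hβ r hr
  obtain ⟨c', hc'⟩ := hβ r' hr'
  simp only [map_add, map_nsmul, hy, smul_eq_mul] at h
  obtain rfl : r = r' := by
    rw [hc, hc'] at h
    have h2 := congrArg (· % (2 * e - 1)) h
    simp only [Nat.mul_mod_left, Nat.add_mod, Nat.mul_mod_right, zero_add, add_zero,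
      Nat.mod_eq_of_lt hr, Nat.mod_eq_of_lt hr'] at h2
    exact h2
  obtain rfl : a = a' := Nat.eq_of_mul_eq_mul_right (by omega) (Nat.add_right_cancel h)
  rfl

end NormalForm

section Binomials

variable {e n : ℕ}

theorem xx_eq_monomial {i : ℕ} (h : i < e ∧ i ≠ 1 ∧ i ≠ n) :
    xx e n i = monomial (varExp e n i) (1 : ℚ) := by
  rw [xx, sX, dif_pos h, varExp, dif_pos h, MvPolynomial.X]

theorem prod_xx_eq_monomial {l : List ℕ} (h : ∀ i ∈ l, i < e ∧ i ≠ 1 ∧ i ≠ n) :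
    (l.map (xx e n)).prod = monomial (l.map (varExp e n)).sum (1 : ℚ) := by
  induction l with
  | nil => simp
  | cons i l ih =>
    rw [List.map_cons, List.prod_cons, ih fun j hj => h j (List.mem_cons_of_mem _ hj),
      xx_eq_monomial (h i List.mem_cons_self), monomial_mul, one_mul, List.map_cons, List.sum_cons]

theorem expWeight_sum_varExp {l : List ℕ} (h : ∀ i ∈ l, i < e ∧ i ≠ 1 ∧ i ≠ n) :
    expWeight e n (l.map (varExp e n)).sum = (l.map (e + ·)).sum := by
  rw [map_list_sum, List.map_map]
  congr 1
  exact List.map_congr_left fun i hi => expWeight_varExp (h i hi).1 (h i hi).2.1 (h i hi).2.2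

theorem sum_varExp_degree {l : List ℕ} (h : ∀ i ∈ l, i < e ∧ i ≠ 1 ∧ i ≠ n) :
    ((l.map (varExp e n)).sum.sum fun _ k => k) = l.length := by
  induction l with
  | nil => simp
  | cons i l ih =>
    rw [List.map_cons, List.sum_cons, sum_exp_add, ih fun j hj => h j (List.mem_cons_of_mem _ hj),
      varExp, dif_pos (h i List.mem_cons_self), Finsupp.sum_single_index rfl, List.length_cons,
      add_comm]

theorem sum_varExp_apply (l : List ℕ) (k : SallyIdx e 1 n) :
    (l.map (varExp e n)).sum k = l.count k.1 := by
  induction l with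
  | nil => simp
  | cons i l ih =>
    rw [List.map_cons, List.sum_cons, Finsupp.add_apply, ih, List.count_cons, add_comm]
    congr 1
    by_cases hi : i = k.1
    · subst hi
      simp [varExp, k.2]
    · by_cases h : i < e ∧ i ≠ 1 ∧ i ≠ n
      · have : (⟨i, h⟩ : SallyIdx e 1 n) ≠ k := fun h' => hi (congrArg Subtype.val h')
        rw [varExp, dif_pos h, Finsupp.single_eq_of_ne' this]
        simp [hi]
      · simp [varExp, h, hi]

theorem sub_mem_sallyIdeal {l l' : List ℕ} (h : ∀ i ∈ l, i < e ∧ i ≠ 1 ∧ i ≠ n)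
    (h' : ∀ i ∈ l', i < e ∧ i ≠ 1 ∧ i ≠ n) (hw : (l.map (e + ·)).sum = (l'.map (e + ·)).sum) :
    (l.map (xx e n)).prod - (l'.map (xx e n)).prod ∈ sallyIdeal e 1 n := by
  have key (l : List ℕ) (h : ∀ i ∈ l, i < e ∧ i ≠ 1 ∧ i ≠ n) :
      aeval (fun i : SallyIdx e 1 n => (Polynomial.X : Polynomial ℚ) ^ (e + i.1))
        (l.map (xx e n)).prod = Polynomial.X ^ (l.map (e + ·)).sum := by
    rw [prod_xx_eq_monomial h, aeval_sally_apply, ← expWeight_sum_varExp h,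
      support_monomial, if_neg one_ne_zero, Finset.sum_singleton, coeff_monomial, if_pos rfl,
      Polynomial.X_pow_eq_monomial]
  rw [sallyIdeal, RingHom.mem_ker]
  simp only [AlgHom.toRingHom_eq_coe, RingHom.coe_coe, map_sub]
  rw [key l h, key l' h', hw, sub_self]

theorem isLeadExp_sub {d d' : SallyIdx e 1 n →₀ ℕ} (h : grevlexLT e 1 n d' d) :
    IsLeadExp e 1 n (monomial d (1 : ℚ) - monomial d' 1) d ∧
      IsLeadExp e 1 n (monomial d' (1 : ℚ) - monomial d 1) d := by
  have hne : d' ≠ d := by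
    rintro rfl
    exact grevlexLT_irrefl _ h
  refine ⟨⟨?_, fun c hc hcd => ?_⟩, ⟨?_, fun c hc hcd => ?_⟩⟩
  · simp [coeff_monomial, hne]
  · by_cases h' : c = d'
    · exact h' ▸ h
    · simp [coeff_monomial, hcd.symm, Ne.symm h'] at hc
  · simp [coeff_monomial, hne]
  · by_cases h' : c = d'
    · exact h' ▸ h
    · simp [coeff_monomial, hcd.symm, Ne.symm h'] at hc

theorem grevlexLT_sum_varExp {l l' : List ℕ} (h : ∀ i ∈ l, i < e ∧ i ≠ 1 ∧ i ≠ n)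
    (h' : ∀ i ∈ l', i < e ∧ i ≠ 1 ∧ i ≠ n)
    (hlt : l'.length < l.length ∨
      l'.length = l.length ∧ ∃ k ∈ l', (∀ i ∈ l, i < k) ∧ ∀ i ∈ l', i ≤ k) :
    grevlexLT e 1 n (l'.map (varExp e n)).sum (l.map (varExp e n)).sum := by
  rw [grevlexLT, sum_varExp_degree h, sum_varExp_degree h']
  refine hlt.imp_right fun ⟨hlen, k, hk, hl, hl'⟩ => ⟨hlen, ⟨k, h' k hk⟩, ?_, fun j hj => ?_⟩
  · rw [sum_varExp_apply, sum_varExp_apply, List.count_eq_zero.2 fun hkl => (hl k hkl).false]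
    exact List.count_pos_iff.2 hk
  · rw [sum_varExp_apply, sum_varExp_apply,
      List.count_eq_zero.2 fun hj' => (hl' _ hj').not_gt hj,
      List.count_eq_zero.2 fun hj' => ((hl _ hj').trans hj).false]

theorem isReducible_of_sub_mem {l l' : List ℕ} (h : ∀ i ∈ l, i < e ∧ i ≠ 1 ∧ i ≠ n)
    (h' : ∀ i ∈ l', i < e ∧ i ≠ 1 ∧ i ≠ n)
    (hlt : l'.length < l.length ∨
      l'.length = l.length ∧ ∃ k ∈ l', (∀ i ∈ l, i < k) ∧ ∀ i ∈ l', i ≤ k)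
    (hmem : (l.map (xx e n)).prod - (l'.map (xx e n)).prod ∈ gbSet e n ∨
      (l'.map (xx e n)).prod - (l.map (xx e n)).prod ∈ gbSet e n) :
    IsReducible e n (l.map (varExp e n)).sum := by
  rw [prod_xx_eq_monomial h, prod_xx_eq_monomial h'] at hmem
  have hlead := isLeadExp_sub (grevlexLT_sum_varExp h h' hlt)
  exact hmem.elim (fun hm => ⟨_, hm, _, hlead.1, le_rfl⟩) fun hm => ⟨_, hm, _, hlead.2, le_rfl⟩

end Binomials

section GeneratorsInIdeal

theorem sub_mem_sallyIdeal_two {e n a b c d : ℕ} (ha : a < e ∧ a ≠ 1 ∧ a ≠ n)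
    (hb : b < e ∧ b ≠ 1 ∧ b ≠ n) (hc : c < e ∧ c ≠ 1 ∧ c ≠ n) (hd : d < e ∧ d ≠ 1 ∧ d ≠ n)
    (h : a + b = c + d) : xx e n a * xx e n b - xx e n c * xx e n d ∈ sallyIdeal e 1 n := by
  simpa using sub_mem_sallyIdeal (l := [a, b]) (l' := [c, d]) (by simp [ha, hb]) (by simp [hc, hd])
    (by simp; omega)

theorem sub_mem_sallyIdeal_three_two {e n a b c d f : ℕ} (ha : a < e ∧ a ≠ 1 ∧ a ≠ n)
    (hb : b < e ∧ b ≠ 1 ∧ b ≠ n) (hc : c < e ∧ c ≠ 1 ∧ c ≠ n) (hd : d < e ∧ d ≠ 1 ∧ d ≠ n)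
    (hf : f < e ∧ f ≠ 1 ∧ f ≠ n) (h : e + a + b + c = d + f) :
    xx e n a * xx e n b * xx e n c - xx e n d * xx e n f ∈ sallyIdeal e 1 n := by
  simpa [mul_assoc] using sub_mem_sallyIdeal (l := [a, b, c]) (l' := [d, f])
    (by simp [ha, hb, hc]) (by simp [hd, hf]) (by simp; omega)

theorem sub_mem_sallyIdeal_three {e n a b c d f g : ℕ} (ha : a < e ∧ a ≠ 1 ∧ a ≠ n)
    (hb : b < e ∧ b ≠ 1 ∧ b ≠ n) (hc : c < e ∧ c ≠ 1 ∧ c ≠ n) (hd : d < e ∧ d ≠ 1 ∧ d ≠ n)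
    (hf : f < e ∧ f ≠ 1 ∧ f ≠ n) (hg : g < e ∧ g ≠ 1 ∧ g ≠ n) (h : a + b + c = d + f + g) :
    xx e n a * xx e n b * xx e n c - xx e n d * xx e n f * xx e n g ∈ sallyIdeal e 1 n := by
  simpa [mul_assoc] using sub_mem_sallyIdeal (l := [a, b, c]) (l' := [d, f, g])
    (by simp [ha, hb, hc]) (by simp [hd, hf, hg]) (by simp; omega)

theorem gbSet_subset_sallyIdeal {e n : ℕ} (he : 10 ≤ e) (hn2 : 2 ≤ n) (hne : n ≤ e - 2) :
    gbSet e n ⊆ sallyIdeal e 1 n := by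
  intro p hp
  simp only [gbSet, Set.mem_union, Set.mem_ofPred_eq, or_assoc] at hp
  rw [SetLike.mem_coe]
  rcases hp with ⟨i, j, hi, hj, hij, rfl⟩ | ⟨i, hi, rfl⟩ | ⟨hn, i, hi, hi', rfl⟩ | ⟨hn, rfl⟩ |
    ⟨hn, i, hi, rfl⟩ | ⟨hn, hn', rfl⟩ | ⟨hn, i, hi, rfl⟩ | ⟨hn, rfl⟩ | ⟨hn, i, hi, rfl⟩ |
    ⟨hn, rfl | rfl | rfl | rfl⟩ | ⟨hn, hn', i, hi, rfl⟩ | ⟨hn, hn', i, hi, rfl⟩ |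
    ⟨hn, hn', rfl | rfl | rfl⟩ | ⟨hn, i, hi, rfl⟩ | ⟨hn, rfl | rfl | rfl⟩ | ⟨hn, i, hi, rfl⟩ |
    ⟨hn, rfl | rfl⟩ | ⟨hn, rfl | rfl⟩ | ⟨hn, hn', rfl⟩ | ⟨hn, rfl | rfl | rfl⟩ <;>
  (try simp only [pow_succ, pow_zero, one_mul, ← mul_assoc]) <;>
  first
  | with_reducible apply sub_mem_sallyIdeal_two <;> omega
  | with_reducible apply sub_mem_sallyIdeal_three_two <;> omega
  | with_reducible apply sub_mem_sallyIdeal_three <;> omega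

end GeneratorsInIdeal

section ReductionRules

variable {e n : ℕ}

theorem isReducible_two {a b c d : ℕ} (ha : a < e ∧ a ≠ 1 ∧ a ≠ n) (hb : b < e ∧ b ≠ 1 ∧ b ≠ n)
    (hc : c < e ∧ c ≠ 1 ∧ c ≠ n) (hd : d < e ∧ d ≠ 1 ∧ d ≠ n) (had : a < d) (hbd : b < d)
    (hcd : c ≤ d)
    (hmem : xx e n a * xx e n b - xx e n c * xx e n d ∈ gbSet e n ∨
      xx e n c * xx e n d - xx e n a * xx e n b ∈ gbSet e n) :
    IsReducible e n (varExp e n a + varExp e n b) := by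
  simpa using isReducible_of_sub_mem (l := [a, b]) (l' := [c, d]) (by simp [ha, hb])
    (by simp [hc, hd]) (Or.inr ⟨rfl, d, by simp, by simp [had, hbd], by simp [hcd]⟩)
    (by simpa using hmem)

theorem isReducible_three_two {a b c d f : ℕ} (ha : a < e ∧ a ≠ 1 ∧ a ≠ n)
    (hb : b < e ∧ b ≠ 1 ∧ b ≠ n) (hc : c < e ∧ c ≠ 1 ∧ c ≠ n) (hd : d < e ∧ d ≠ 1 ∧ d ≠ n)
    (hf : f < e ∧ f ≠ 1 ∧ f ≠ n)
    (hmem : xx e n a * xx e n b * xx e n c - xx e n d * xx e n f ∈ gbSet e n) :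
    IsReducible e n (varExp e n a + varExp e n b + varExp e n c) := by
  simpa [add_assoc] using isReducible_of_sub_mem (l := [a, b, c]) (l' := [d, f])
    (by simp [ha, hb, hc]) (by simp [hd, hf]) (Or.inl (by simp))
    (Or.inl (by simpa [mul_assoc] using hmem))

theorem isReducible_three {a b c d f g : ℕ} (ha : a < e ∧ a ≠ 1 ∧ a ≠ n)
    (hb : b < e ∧ b ≠ 1 ∧ b ≠ n) (hc : c < e ∧ c ≠ 1 ∧ c ≠ n) (hd : d < e ∧ d ≠ 1 ∧ d ≠ n)
    (hf : f < e ∧ f ≠ 1 ∧ f ≠ n) (hg : g < e ∧ g ≠ 1 ∧ g ≠ n) (hag : a < g) (hbg : b < g)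
    (hcg : c < g) (hdg : d ≤ g) (hfg : f ≤ g)
    (hmem : xx e n a * xx e n b * xx e n c - xx e n d * xx e n f * xx e n g ∈ gbSet e n) :
    IsReducible e n (varExp e n a + varExp e n b + varExp e n c) := by
  simpa [add_assoc] using isReducible_of_sub_mem (l := [a, b, c]) (l' := [d, f, g])
    (by simp [ha, hb, hc]) (by simp [hd, hf, hg])
    (Or.inr ⟨rfl, g, by simp, by simp [hag, hbg, hcg], by simp [hdg, hfg]⟩)
    (Or.inl (by simpa [mul_assoc] using hmem))

theorem isReducible_minor (hn2 : 2 ≤ n) {a b : ℕ} (ha : 3 ≤ a) (hab : a ≤ b) (hb : b ≤ e - 2)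
    (han : a ≠ n) (han' : a ≠ n + 1) (hbn : b ≠ n) (hbn' : b ≠ n - 1) :
    IsReducible e n (varExp e n a + varExp e n b) := by
  refine isReducible_two (c := a - 1) (d := b + 1) (by omega) (by omega) (by omega) (by omega)
    (by omega) (by omega) (by omega) ?_
  refine Or.inr ?_
  simp only [gbSet, Set.mem_union, Set.mem_ofPred_eq, or_assoc]
  left
  exact ⟨a - 1, b, by omega, by omega, by omega, by rw [Nat.sub_add_cancel (by omega)]⟩

theorem isReducible_zero_zero (hn2 : 2 ≤ n) (hne : n ≤ e - 2) {i : ℕ} (hi : 2 ≤ i)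
    (hie : i ≤ e - 2) (hin : i ≠ n)
    (hin' : i ≠ n - 1) :
    IsReducible e n (varExp e n 0 + varExp e n 0 + varExp e n i) := by
  refine isReducible_three_two (d := i + 1) (f := e - 1) (by omega) (by omega) (by omega)
    (by omega) (by omega) ?_
  simp only [gbSet, Set.mem_union, Set.mem_ofPred_eq, or_assoc]
  right
  left
  exact ⟨i, by omega, by ring⟩

theorem isReducible_three_add_of_eq_two (hn : n = 2) {i : ℕ} (hi : 3 ≤ i) (hie : i ≤ e - 4) :
    IsReducible e n (varExp e n 3 + varExp e n i) := by
  refine isReducible_two (c := 0) (d := i + 3) (by omega) (by omega) (by omega) (by omega)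
    (by omega) (by omega) (by omega) ?_
  refine Or.inr ?_
  simp only [gbSet, Set.mem_union, Set.mem_ofPred_eq, or_assoc]
  iterate 2 right
  left
  exact ⟨hn, i, hi, hie, rfl⟩

theorem isReducible_zero_cubed_of_eq_two (he : 10 ≤ e) (hn : n = 2) :
    IsReducible e n (varExp e n 0 + varExp e n 0 + varExp e n 0) := by
  refine isReducible_three_two (d := 3) (f := e - 3) (by omega) (by omega) (by omega) (by omega)
    (by omega) ?_
  simp only [gbSet, Set.mem_union, Set.mem_ofPred_eq, or_assoc]
  iterate 3 right
  left
  exact ⟨hn, by ring⟩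

theorem isReducible_two_add (hn : 3 ≤ n) {i : ℕ} (hi : 2 ≤ i) (hie : i ≤ e - 3) (hin : i ≠ n)
    (hin' : i ≠ n - 2) :
    IsReducible e n (varExp e n 2 + varExp e n i) := by
  refine isReducible_two (c := 0) (d := i + 2) (by omega) (by omega) (by omega) (by omega)
    (by omega) (by omega) (by omega) ?_
  refine Or.inr ?_
  simp only [gbSet, Set.mem_union, Set.mem_ofPred_eq, or_assoc]
  iterate 4 right
  left
  exact ⟨hn, i, by omega, rfl⟩

theorem isReducible_zero_cubed (hn : 3 ≤ n) (hne : n ≤ e - 3) :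
    IsReducible e n (varExp e n 0 + varExp e n 0 + varExp e n 0) := by
  refine isReducible_three_two (d := 2) (f := e - 2) (by omega) (by omega) (by omega) (by omega)
    (by omega) ?_
  simp only [gbSet, Set.mem_union, Set.mem_ofPred_eq, or_assoc]
  iterate 5 right
  left
  exact ⟨hn, hne, by ring⟩

theorem isReducible_four_add_of_eq_three (hn : n = 3) {i : ℕ} (hi : 4 ≤ i) (hie : i ≤ e - 3) :
    IsReducible e n (varExp e n 4 + varExp e n i) := by
  refine isReducible_two (c := 2) (d := i + 2) (by omega) (by omega) (by omega) (by omega)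
    (by omega) (by omega) (by omega) ?_
  refine Or.inl ?_
  simp only [gbSet, Set.mem_union, Set.mem_ofPred_eq, or_assoc]
  iterate 6 right
  left
  exact ⟨hn, i - 4, by omega, by rw [show 4 + (i - 4) = i by omega, show 6 +
    (i - 4) = i + 2 by omega]⟩

theorem isReducible_zero_zero_two_of_eq_three (he : 10 ≤ e) (hn : n = 3) :
    IsReducible e n (varExp e n 0 + varExp e n 0 + varExp e n 2) := by
  refine isReducible_three_two (d := 4) (f := e - 2) (by omega) (by omega) (by omega) (by omega)
    (by omega) ?_
  simp only [gbSet, Set.mem_union, Set.mem_ofPred_eq, or_assoc]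
  iterate 7 right
  left
  exact ⟨hn, by ring⟩

theorem isReducible_succ_add (he : 10 ≤ e) (hn4 : 4 ≤ n) (hne : n ≤ e - 3) {i : ℕ}
    (hi : n + 1 ≤ i) (hie : i ≤ e - 3) :
    IsReducible e n (varExp e n (n + 1) + varExp e n i) := by
  obtain h | h : n = 4 ∨ 5 ≤ n ∧ n ≤ e - 4 := by omega
  · subst h
    refine isReducible_two (c := 3) (d := i + 2) (by omega) (by omega) (by omega) (by omega)
      (by omega) (by omega) (by omega) ?_
    refine Or.inl ?_
    simp only [gbSet, Set.mem_union, Set.mem_ofPred_eq, or_assoc]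
    iterate 8 right
    left
    exact ⟨trivial, i - 5, by omega,
      by rw [show 5 + (i - 5) = i by omega, show 7 + (i - 5) = i + 2 by omega]⟩
  · refine isReducible_two (c := n - 1) (d := i + 2) (by omega) (by omega) (by omega) (by omega)
      (by omega) (by omega) (by omega) ?_
    refine Or.inl ?_
    simp only [gbSet, Set.mem_union, Set.mem_ofPred_eq, or_assoc]
    iterate 10 right
    left
    exact ⟨h.1, h.2, i - (n + 1), by omega,
      by rw [show n + 1 + (i - (n + 1)) = i by omega, show n + 3 + (i - (n + 1)) = i + 2 by omega]⟩

theorem isReducible_pred_add (he : 10 ≤ e) (hn4 : 4 ≤ n) (hne : n ≤ e - 3) {i : ℕ} (hi : 3 ≤ i)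
    (hie : i ≤ n - 1) :
    IsReducible e n (varExp e n (n - 1) + varExp e n i) := by
  obtain h | h | h | h | h : n = 4 ∨ 5 ≤ n ∧ n ≤ e - 4 ∧ 4 ≤ i ∨ 5 ≤ n ∧ n ≤ e - 4 ∧ i = 3 ∨ e = n + 3 ∧ 4 ≤ i ∨ e = n + 3 ∧ i = 3 := by omega
  · subst h
    refine isReducible_two (c := 0) (d := 6) (by omega) (by omega) (by omega) (by omega)
      (by omega) (by omega) (by omega) ?_
    refine Or.inl ?_
    simp only [gbSet, Set.mem_union, Set.mem_ofPred_eq, or_assoc]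
    iterate 9 right
    left
    obtain rfl : i = 3 := by omega
    exact ⟨trivial, Or.inl (by ring)⟩
  · refine isReducible_two (c := i - 2) (d := n + 1) (by omega) (by omega) (by omega) (by omega)
      (by omega) (by omega) (by omega) ?_
    refine Or.inl ?_
    simp only [gbSet, Set.mem_union, Set.mem_ofPred_eq, or_assoc]
    iterate 11 right
    left
    exact ⟨h.1, h.2.1, n - 1 - i, by omega, by
      rw [show n - 1 - (n - 1 - i) = i by omega, show n - 3 - (n - 1 - i) = i - 2 by omega]; ring⟩
  · refine isReducible_two (c := 0) (d := n + 2) (by omega) (by omega) (by omega) (by omega)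
      (by omega) (by omega) (by omega) ?_
    refine Or.inl ?_
    simp only [gbSet, Set.mem_union, Set.mem_ofPred_eq, or_assoc]
    iterate 12 right
    left
    exact ⟨h.1, h.2.1, Or.inl (by rw [h.2.2]; ring)⟩
  · refine isReducible_two (c := i - 2) (d := n + 1) (by omega) (by omega) (by omega) (by omega)
      (by omega) (by omega) (by omega) ?_
    refine Or.inl ?_
    simp only [gbSet, Set.mem_union, Set.mem_ofPred_eq, or_assoc]
    iterate 13 right
    left
    exact ⟨by omega, n - 1 - i, by omega, by
      rw [show e - 4 = n - 1 by omega, show e - 2 = n + 1 by omega,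
        show n - 1 - (n - 1 - i) = i by omega, show e - 6 - (n - 1 - i) = i - 2 by omega]; ring⟩
  · refine isReducible_two (c := 0) (d := n + 2) (by omega) (by omega) (by omega) (by omega)
      (by omega) (by omega) (by omega) ?_
    refine Or.inl ?_
    simp only [gbSet, Set.mem_union, Set.mem_ofPred_eq, or_assoc]
    iterate 14 right
    left
    exact ⟨by omega, Or.inl (by rw [show e - 4 = n - 1 by omega, show e - 1 = n + 2 by omega, h.2])⟩

theorem isReducible_zero_zero_pred (he : 10 ≤ e) (hn4 : 4 ≤ n) (hne : n ≤ e - 3) :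
    IsReducible e n (varExp e n 0 + varExp e n 0 + varExp e n (n - 1)) := by
  obtain h | h | h : n = 4 ∨ 5 ≤ n ∧ n ≤ e - 4 ∨ e = n + 3 := by omega
  · subst h
    refine isReducible_three_two (d := 5) (f := e - 2) (by omega) (by omega) (by omega) (by omega)
      (by omega) ?_
    simp only [gbSet, Set.mem_union, Set.mem_ofPred_eq, or_assoc]
    iterate 9 right
    left
    exact ⟨trivial, Or.inr (Or.inl (by ring))⟩
  · refine isReducible_three_two (d := n + 1) (f := e - 2) (by omega) (by omega) (by omega)
      (by omega) (by omega) ?_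
    simp only [gbSet, Set.mem_union, Set.mem_ofPred_eq, or_assoc]
    iterate 12 right
    left
    exact ⟨h.1, h.2, Or.inr (Or.inl (by ring))⟩
  · subst h
    refine isReducible_three_two (d := n + 1) (f := n + 1) (by omega) (by omega) (by omega)
      (by omega) (by omega) ?_
    simp only [gbSet, Set.mem_union, Set.mem_ofPred_eq, or_assoc]
    iterate 14 right
    left
    exact ⟨rfl, Or.inr (Or.inl (by
      rw [show n + 3 - 4 = n - 1 by omega, show n + 3 - 2 = n + 1 by omega]; ring))⟩

theorem isReducible_zero_two_pred (he : 10 ≤ e) (hn4 : 4 ≤ n) (hne : n ≤ e - 3) :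
    IsReducible e n (varExp e n 0 + varExp e n 2 + varExp e n (n - 2)) := by
  obtain h | h | h : n = 4 ∨ 5 ≤ n ∧ n ≤ e - 4 ∨ e = n + 3 := by omega
  · subst h
    refine isReducible_three_two (d := 5) (f := e - 1) (by omega) (by omega) (by omega) (by omega)
      (by omega) ?_
    simp only [gbSet, Set.mem_union, Set.mem_ofPred_eq, or_assoc]
    iterate 9 right
    left
    exact ⟨trivial, Or.inr (Or.inr (Or.inl (by ring)))⟩
  · refine isReducible_three_two (d := n + 1) (f := e - 1) (by omega) (by omega) (by omega)
      (by omega) (by omega) ?_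
    simp only [gbSet, Set.mem_union, Set.mem_ofPred_eq, or_assoc]
    iterate 12 right
    left
    exact ⟨h.1, h.2, Or.inr (Or.inr trivial)⟩
  · subst h
    refine isReducible_three_two (d := n + 1) (f := n + 2) (by omega) (by omega) (by omega)
      (by omega) (by omega) ?_
    simp only [gbSet, Set.mem_union, Set.mem_ofPred_eq, or_assoc]
    iterate 14 right
    left
    exact ⟨rfl, Or.inr (Or.inr (by
      rw [show n + 3 - 5 = n - 2 by omega, show n + 3 - 2 = n + 1 by omega,
        show n + 3 - 1 = n + 2 by omega]))⟩

theorem isReducible_zero_succ (he : 10 ≤ e) (hn4 : 4 ≤ n) (hne : n ≤ e - 3) :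
    IsReducible e n (varExp e n 0 + varExp e n (n + 1) + varExp e n (e - 2)) := by
  obtain h | h | h : n = 4 ∨ 5 ≤ n ∧ n ≤ e - 4 ∨ e = n + 3 := by omega
  · subst h
    refine isReducible_three (d := 2) (f := 2) (g := e - 1) (by omega) (by omega) (by omega)
      (by omega) (by omega) (by omega) (by omega) (by omega) (by omega) (by omega) (by omega) ?_
    simp only [gbSet, Set.mem_union, Set.mem_ofPred_eq, or_assoc]
    iterate 17 right
    left
    exact ⟨trivial, Or.inl (by ring)⟩
  · refine isReducible_three (d := 2) (f := n - 2) (g := e - 1) (by omega) (by omega) (by omega)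
      (by omega) (by omega) (by omega) (by omega) (by omega) (by omega) (by omega) (by omega) ?_
    simp only [gbSet, Set.mem_union, Set.mem_ofPred_eq, or_assoc]
    iterate 18 right
    left
    exact ⟨h.1, h.2, trivial⟩
  · subst h
    refine isReducible_three (d := 2) (f := n - 2) (g := n + 2) (by omega) (by omega) (by omega)
      (by omega) (by omega) (by omega) (by omega) (by omega) (by omega) (by omega) (by omega) ?_
    simp only [gbSet, Set.mem_union, Set.mem_ofPred_eq, or_assoc]
    iterate 19 right
    exact ⟨rfl, Or.inr (Or.inr (by
      rw [show n + 3 - 5 = n - 2 by omega, show n + 3 - 2 = n + 1 by omega,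
        show n + 3 - 1 = n + 2 by omega]; ring))⟩

theorem isReducible_two_cubed_of_eq_four (he : 10 ≤ e) (hn : n = 4) :
    IsReducible e n (varExp e n 2 + varExp e n 2 + varExp e n 2) := by
  refine isReducible_three_two (d := 7) (f := e - 1) (by omega) (by omega) (by omega) (by omega)
    (by omega) ?_
  simp only [gbSet, Set.mem_union, Set.mem_ofPred_eq, or_assoc]
  iterate 9 right
  left
  exact ⟨hn, Or.inr (Or.inr (Or.inr (by ring)))⟩

theorem isReducible_two_two_of_eq_four (he : 10 ≤ e) (hn : n = 4) :
    IsReducible e n (varExp e n 2 + varExp e n 2 + varExp e n (e - 2)) := by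
  refine isReducible_three (d := 0) (f := 3) (g := e - 1) (by omega) (by omega) (by omega)
    (by omega) (by omega) (by omega) (by omega) (by omega) (by omega) (by omega) (by omega) ?_
  simp only [gbSet, Set.mem_union, Set.mem_ofPred_eq, or_assoc]
  iterate 17 right
  left
  exact ⟨hn, Or.inr (by ring)⟩

theorem isReducible_cubed_of_eq_sub_three (he : 10 ≤ e) (hn : n = e - 3) :
    IsReducible e n (varExp e n (e - 2) + varExp e n (e - 2) + varExp e n (e - 2)) := by
  refine isReducible_three (d := e - 4) (f := e - 1) (g := e - 1) (by omega) (by omega) (by omega)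
    (by omega) (by omega) (by omega) (by omega) (by omega) (by omega) (by omega) (by omega) ?_
  simp only [gbSet, Set.mem_union, Set.mem_ofPred_eq, or_assoc]
  iterate 19 right
  exact ⟨hn, Or.inl (by ring)⟩

theorem isReducible_two_sq_of_eq_sub_three (he : 10 ≤ e) (hn : n = e - 3) :
    IsReducible e n (varExp e n 2 + varExp e n (e - 2) + varExp e n (e - 2)) := by
  refine isReducible_three (d := 0) (f := e - 1) (g := e - 1) (by omega) (by omega) (by omega)
    (by omega) (by omega) (by omega) (by omega) (by omega) (by omega) (by omega) (by omega) ?_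
  simp only [gbSet, Set.mem_union, Set.mem_ofPred_eq, or_assoc]
  iterate 19 right
  exact ⟨hn, Or.inr (Or.inl (by ring))⟩

theorem isReducible_pred_add_of_eq_sub_two (he : 10 ≤ e) (hn : n = e - 2) {i : ℕ} (hi : 4 ≤ i)
    (hie : i ≤ e - 3) :
    IsReducible e n (varExp e n (e - 3) + varExp e n i) := by
  refine isReducible_two (c := i - 2) (d := e - 1) (by omega) (by omega) (by omega) (by omega)
    (by omega) (by omega) (by omega) ?_
  refine Or.inl ?_
  simp only [gbSet, Set.mem_union, Set.mem_ofPred_eq, or_assoc]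
  iterate 15 right
  left
  exact ⟨hn, e - 3 - i, by omega, by
    rw [show e - 3 - (e - 3 - i) = i by omega, show e - 5 - (e - 3 - i) = i - 2 by omega]; ring⟩

theorem isReducible_zero_cubed_of_eq_sub_two (he : 10 ≤ e) (hn : n = e - 2) :
    IsReducible e n (varExp e n 0 + varExp e n 0 + varExp e n 0) := by
  refine isReducible_three_two (d := 3) (f := e - 3) (by omega) (by omega) (by omega) (by omega)
    (by omega) ?_
  simp only [gbSet, Set.mem_union, Set.mem_ofPred_eq, or_assoc]
  iterate 16 right
  left
  exact ⟨hn, Or.inl (by ring)⟩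

theorem isReducible_zero_two_of_eq_sub_two (he : 10 ≤ e) (hn : n = e - 2) :
    IsReducible e n (varExp e n 0 + varExp e n 2 + varExp e n (e - 4)) := by
  refine isReducible_three_two (d := e - 1) (f := e - 1) (by omega) (by omega) (by omega)
    (by omega) (by omega) ?_
  simp only [gbSet, Set.mem_union, Set.mem_ofPred_eq, or_assoc]
  iterate 16 right
  left
  exact ⟨hn, Or.inr (by ring)⟩

end ReductionRules

section NormalExponents

variable {e n : ℕ}

/-- The irreducible exponents not involving `x_{e-1}`; the exponents `a`, `b`, `c`, `d` account
for the residues `2`, `n + 1`, `e + 1`, `e + n` of the weight modulo `2 * e - 1`. -/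
def IsNormalExp (e n : ℕ) (a b c d x : SallyIdx e 1 n →₀ ℕ) : Prop :=
  x = 0 ∨ (∃ i, (i < e - 1 ∧ i ≠ 1 ∧ i ≠ n) ∧ x = varExp e n i) ∨
    (∃ i, (i < e - 1 ∧ i ≠ 1 ∧ i ≠ n) ∧ x = varExp e n 0 + varExp e n i) ∨
    x = a ∨ x = b ∨ x = c ∨ x = d

/-- The normal exponent whose weight is congruent to `r` modulo `2 * e - 1`. -/
noncomputable def normalExp (e n : ℕ) (a b c d : SallyIdx e 1 n →₀ ℕ) (r : ℕ) :
    SallyIdx e 1 n →₀ ℕ :=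
  if r = 0 then 0 else if r = 2 then a else if r = n + 1 then b
  else if r < e then varExp e n 0 + varExp e n (r - 1)
  else if r = e + 1 then c else if r = e + n then d else varExp e n (r - e)

theorem isNormalExp_iff (he : 3 ≤ e) (hn2 : 2 ≤ n) (hne : n ≤ e - 2)
    (a b c d x : SallyIdx e 1 n →₀ ℕ) :
    IsNormalExp e n a b c d x ↔ ∃ r < 2 * e - 1, x = normalExp e n a b c d r := by
  constructor
  · rintro (rfl | ⟨i, hi, rfl⟩ | ⟨i, hi, rfl⟩ | rfl | rfl | rfl | rfl)
    · exact ⟨0, by omega, by simp [normalExp]⟩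
    · refine ⟨e + i, by omega, ?_⟩
      rw [normalExp, if_neg (by omega), if_neg (by omega), if_neg (by omega), if_neg (by omega),
        if_neg (by omega), if_neg (by omega), Nat.add_sub_cancel_left]
    · refine ⟨i + 1, by omega, ?_⟩
      rw [normalExp, if_neg (by omega), if_neg (by omega), if_neg (by omega), if_pos (by omega),
        Nat.add_sub_cancel]
    · exact ⟨2, by omega, by simp [normalExp]⟩
    · refine ⟨n + 1, by omega, ?_⟩
      rw [normalExp, if_neg (by omega), if_neg (by omega), if_pos rfl]
    · refine ⟨e + 1, by omega, ?_⟩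
      rw [normalExp, if_neg (by omega), if_neg (by omega), if_neg (by omega), if_neg (by omega),
        if_pos rfl]
    · refine ⟨e + n, by omega, ?_⟩
      rw [normalExp, if_neg (by omega), if_neg (by omega), if_neg (by omega), if_neg (by omega),
        if_neg (by omega), if_pos rfl]
  · rintro ⟨r, hr, rfl⟩
    unfold normalExp IsNormalExp
    split_ifs with h0 h2 hn he' he1 hen
    · exact Or.inl rfl
    · simp
    · simp
    · exact Or.inr (Or.inr (Or.inl ⟨r - 1, by omega, rfl⟩))
    · simp
    · simp
    · exact Or.inr (Or.inl ⟨r - e, by omega, rfl⟩)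

theorem exists_expWeight_normalExp (he : 3 ≤ e) (hn2 : 2 ≤ n)
    {a b c d : SallyIdx e 1 n →₀ ℕ}
    (ha : ∃ k, expWeight e n a = 2 + (2 * e - 1) * k)
    (hb : ∃ k, expWeight e n b = n + 1 + (2 * e - 1) * k)
    (hc : ∃ k, expWeight e n c = e + 1 + (2 * e - 1) * k)
    (hd : ∃ k, expWeight e n d = e + n + (2 * e - 1) * k) (r : ℕ) (hr : r < 2 * e - 1) :
    ∃ k, expWeight e n (normalExp e n a b c d r) = r + (2 * e - 1) * k := by
  unfold normalExp
  split_ifs with h0 h2 hn he' he1 hen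
  · exact ⟨0, by simp [h0]⟩
  · exact h2 ▸ ha
  · exact hn ▸ hb
  · refine ⟨1, ?_⟩
    rw [map_add, expWeight_varExp (by omega) (by omega) (by omega),
      expWeight_varExp (by omega) (by omega) (by omega)]
    omega
  · exact he1 ▸ hc
  · exact hen ▸ hd
  · exact ⟨0, by rw [expWeight_varExp (by omega) (by omega) (by omega)]; omega⟩

/-- A criterion for `gbSet` to be a Gröbner basis: reducing the product of a variable and a normal
monomial is only necessary in degree two, and for products involving `x_0` or one of the four
special monomials. -/
theorem span_lmSet_eq_of_isNormalExp (he : 10 ≤ e) (hn2 : 2 ≤ n) (hne : n ≤ e - 2)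
    (a b c d : SallyIdx e 1 n →₀ ℕ)
    (ha : ∃ k, expWeight e n a = 2 + (2 * e - 1) * k)
    (hb : ∃ k, expWeight e n b = n + 1 + (2 * e - 1) * k)
    (hc : ∃ k, expWeight e n c = e + 1 + (2 * e - 1) * k)
    (hd : ∃ k, expWeight e n d = e + n + (2 * e - 1) * k)
    (htwo : ∀ i j, 2 ≤ i → i ≤ j → j ≤ e - 2 → i ≠ n → j ≠ n →
      (IsReducible e n (varExp e n i + varExp e n j) ∨
        IsNormalExp e n a b c d (varExp e n i + varExp e n j)) ∧
      (IsReducible e n (varExp e n 0 + (varExp e n i + varExp e n j)) ∨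
        IsNormalExp e n a b c d (varExp e n 0 + (varExp e n i + varExp e n j))))
    (hzero : ∀ i, i ≤ e - 2 → i ≠ 1 → i ≠ n →
      IsReducible e n (varExp e n 0 + varExp e n 0 + varExp e n i) ∨
        IsNormalExp e n a b c d (varExp e n 0 + varExp e n 0 + varExp e n i))
    (hspecial : ∀ i, i ≤ e - 2 → i ≠ 1 → i ≠ n → ∀ x, x = a ∨ x = b ∨ x = c ∨ x = d →
      IsReducible e n (varExp e n i + x) ∨ IsNormalExp e n a b c d (varExp e n i + x)) :
    Ideal.span (lmSet e 1 n (gbSet e n)) =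
      Ideal.span (lmSet e 1 n (sallyIdeal e 1 n : Set (MvPolynomial (SallyIdx e 1 n) ℚ))) := by
  refine span_lmSet_eq (gbSet_subset_sallyIdeal he hn2 hne)
    (eq_of_expWeight_eq (normalExp e n a b c d) (if_pos rfl) (by omega) hne ?_
      (exists_expWeight_normalExp (by omega) hn2 ha hb hc hd))
  intro r hr i hi hi1 hin
  rw [← isNormalExp_iff (by omega) hn2 hne]
  have hx := (isNormalExp_iff (by omega) hn2 hne a b c d _).2 ⟨r, hr, rfl⟩
  generalize normalExp e n a b c d r = x at hx ⊢
  rcases hx with rfl | ⟨j, hj, rfl⟩ | ⟨j, hj, rfl⟩ | hx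
  · exact Or.inr (Or.inr (Or.inl ⟨i, ⟨hi, hi1, hin⟩, add_zero _⟩))
  · rcases Nat.eq_zero_or_pos i with rfl | hi0
    · exact Or.inr (Or.inr (Or.inr (Or.inl ⟨j, hj, rfl⟩)))
    rcases Nat.eq_zero_or_pos j with rfl | hj0
    · exact Or.inr (Or.inr (Or.inr (Or.inl ⟨i, ⟨hi, hi1, hin⟩, add_comm _ _⟩)))
    rcases le_total i j with hij | hij
    · exact (htwo i j (by omega) hij (by omega) hin hj.2.2).1
    · rw [add_comm]
      exact (htwo j i (by omega) hij (by omega) hj.2.2 hin).1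
  · rcases Nat.eq_zero_or_pos i with rfl | hi0
    · rw [← add_assoc]
      exact hzero j (by omega) hj.2.1 hj.2.2
    rcases Nat.eq_zero_or_pos j with rfl | hj0
    · rw [add_comm]
      exact hzero i (by omega) hi1 hin
    rcases le_total i j with hij | hij
    · rw [add_left_comm]
      exact (htwo i j (by omega) hij (by omega) hin hj.2.2).2
    · rw [add_left_comm, add_comm (varExp e n i)]
      exact (htwo j i (by omega) hij (by omega) hj.2.2 hin).2
  · exact hspecial i (by omega) hi1 hin x (by tauto)

end NormalExponents

section GroebnerCases

variable {e n : ℕ}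

theorem span_lmSet_eq_of_eq_two (he : 10 ≤ e) (hn : n = 2) :
    Ideal.span (lmSet e 1 n (gbSet e n)) =
      Ideal.span (lmSet e 1 n (sallyIdeal e 1 n : Set (MvPolynomial (SallyIdx e 1 n) ℚ))) := by
  have hcube : IsReducible e n (varExp e n 0 + varExp e n 0 + varExp e n 0) :=
    isReducible_zero_cubed_of_eq_two he hn
  have hsq (i : ℕ) (hi : 3 ≤ i) (hie : i ≤ e - 2) :
      IsReducible e n (varExp e n 0 + varExp e n 0 + varExp e n i) :=
    isReducible_zero_zero (by omega) (by omega) (by omega) hie (by omega) (by omega)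
  have htwo (i j : ℕ) (hi : 3 ≤ i) (hij : i ≤ j) (hj : j ≤ e - 2) :
      IsReducible e n (varExp e n i + varExp e n j) ∨ i = 3 ∧ (j = e - 3 ∨ j = e - 2) := by
    by_cases hi3 : i = 3
    · by_cases hj' : j ≤ e - 4
      · exact Or.inl (hi3 ▸ isReducible_three_add_of_eq_two hn (by omega) hj')
      · exact Or.inr (by omega)
    · exact Or.inl (isReducible_minor (by omega) hi hij hj (by omega) (by omega) (by omega)
        (by omega))
  have hthree (i j : ℕ) (hi : 3 ≤ i) (hie : i ≤ e - 2) (hj : j = e - 3 ∨ j = e - 2) :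
      IsReducible e n (varExp e n i + (varExp e n 3 + varExp e n j)) := by
    by_cases hi3 : i = 3
    · subst hi3
      exact ((htwo 3 3 le_rfl le_rfl (by omega)).resolve_right (by omega)).of_add_eq
        (c := varExp e n j) (by abel)
    rcases le_total i j with hij | hij
    · exact ((htwo i j hi hij (by omega)).resolve_right (by omega)).of_add_eq
        (c := varExp e n 3) (by abel)
    · exact ((htwo j i (by omega) hij (by omega)).resolve_right (by omega)).of_add_eq
        (c := varExp e n 3) (by abel)
  have hw (i : ℕ) (hi : i < e ∧ i ≠ 1 ∧ i ≠ n) : expWeight e n (varExp e n i) = e + i :=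
    expWeight_varExp hi.1 hi.2.1 hi.2.2
  refine span_lmSet_eq_of_isNormalExp he (by omega) (by omega)
    (varExp e n 0 + (varExp e n 3 + varExp e n (e - 3)))
    (varExp e n 0 + (varExp e n 3 + varExp e n (e - 2)))
    (varExp e n 3 + varExp e n (e - 3)) (varExp e n 3 + varExp e n (e - 2))
    ⟨2, ?_⟩ ⟨2, ?_⟩ ⟨1, ?_⟩ ⟨1, ?_⟩ (fun i j hi hij hj hin hjn => ?_) (fun i hi hi1 hin => ?_)
    (fun i hi hi1 hin x hx => ?_)
  · rw [map_add, map_add, hw _ (by omega), hw _ (by omega), hw _ (by omega)]; omega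
  · rw [map_add, map_add, hw _ (by omega), hw _ (by omega), hw _ (by omega)]; omega
  · rw [map_add, hw _ (by omega), hw _ (by omega)]; omega
  · rw [map_add, hw _ (by omega), hw _ (by omega)]; omega
  · rcases htwo i j (by omega) hij hj with h | ⟨rfl, rfl | rfl⟩
    · exact ⟨Or.inl h, Or.inl (h.of_add_eq rfl)⟩
    · exact ⟨Or.inr (by simp [IsNormalExp]), Or.inr (by simp [IsNormalExp])⟩
    · exact ⟨Or.inr (by simp [IsNormalExp]), Or.inr (by simp [IsNormalExp])⟩
  · rcases Nat.eq_zero_or_pos i with rfl | hi0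
    · exact Or.inl hcube
    · exact Or.inl (hsq i (by omega) hi)
  · rcases Nat.eq_zero_or_pos i with rfl | hi0
    · rcases hx with rfl | rfl | rfl | rfl
      · exact Or.inl ((hsq 3 le_rfl (by omega)).of_add_eq (c := varExp e n (e - 3)) (by abel))
      · exact Or.inl ((hsq 3 le_rfl (by omega)).of_add_eq (c := varExp e n (e - 2)) (by abel))
      · exact Or.inr (by simp [IsNormalExp])
      · exact Or.inr (by simp [IsNormalExp])
    · have h1 := hthree i (e - 3) (by omega) hi (Or.inl rfl)
      have h2 := hthree i (e - 2) (by omega) hi (Or.inr rfl)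
      rcases hx with rfl | rfl | rfl | rfl
      · exact Or.inl (h1.of_add_eq (c := varExp e n 0) (by abel))
      · exact Or.inl (h2.of_add_eq (c := varExp e n 0) (by abel))
      · exact Or.inl h1
      · exact Or.inl h2

theorem span_lmSet_eq_of_eq_three (he : 10 ≤ e) (hn : n = 3) :
    Ideal.span (lmSet e 1 n (gbSet e n)) =
      Ideal.span (lmSet e 1 n (sallyIdeal e 1 n : Set (MvPolynomial (SallyIdx e 1 n) ℚ))) := by
  have hsq (i : ℕ) (hi1 : i ≠ 1) (hin : i ≠ n) (hie : i ≤ e - 2) :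
      IsReducible e n (varExp e n 0 + varExp e n 0 + varExp e n i) := by
    obtain rfl | rfl | hi : i = 0 ∨ i = 2 ∨ 4 ≤ i := by omega
    · exact isReducible_zero_cubed (by omega) (by omega)
    · exact isReducible_zero_zero_two_of_eq_three he hn
    · exact isReducible_zero_zero (by omega) (by omega) (by omega) hie (by omega) (by omega)
  have htwo (i j : ℕ) (hi : 2 ≤ i) (hij : i ≤ j) (hj : j ≤ e - 2) (hin : i ≠ n) (hjn : j ≠ n) :
      IsReducible e n (varExp e n i + varExp e n j) ∨ (i = 2 ∨ i = 4) ∧ j = e - 2 := by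
    obtain h | rfl | rfl | hi5 :
      ((i = 2 ∨ i = 4) ∧ j = e - 2) ∨ i = 2 ∨ i = 4 ∨ 5 ≤ i := by omega
    · exact Or.inr h
    · by_cases hj' : j = e - 2
      · exact Or.inr ⟨Or.inl rfl, hj'⟩
      · exact Or.inl (isReducible_two_add (by omega) hij (by omega) hjn (by omega))
    · by_cases hj' : j = e - 2
      · exact Or.inr ⟨Or.inr rfl, hj'⟩
      · exact Or.inl (isReducible_four_add_of_eq_three hn hij (by omega))
    · exact Or.inl (isReducible_minor (by omega) (by omega) hij hj (by omega) (by omega) (by omega)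
        (by omega))
  have hlast (i j : ℕ) (hi : 2 ≤ i) (hin : i ≠ n) (hie : i ≤ e - 2) (hj : j = 2 ∨ j = 4) :
      IsReducible e n (varExp e n i + (varExp e n j + varExp e n (e - 2))) := by
    by_cases hi5 : 5 ≤ i
    · exact ((htwo i (e - 2) hi hie le_rfl hin (by omega)).resolve_right (by omega)).of_add_eq
        (c := varExp e n j) (by abel)
    rcases le_total i j with hij | hij
    · exact ((htwo i j hi hij (by omega) hin (by omega)).resolve_right (by omega)).of_add_eq
        (c := varExp e n (e - 2)) (by abel)
    · exact ((htwo j i (by omega) hij (by omega) (by omega) hin).resolve_right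
        (by omega)).of_add_eq (c := varExp e n (e - 2)) (by abel)
  have hw (i : ℕ) (hi : i < e ∧ i ≠ 1 ∧ i ≠ n) : expWeight e n (varExp e n i) = e + i :=
    expWeight_varExp hi.1 hi.2.1 hi.2.2
  refine span_lmSet_eq_of_isNormalExp he (by omega) (by omega)
    (varExp e n 0 + (varExp e n 2 + varExp e n (e - 2)))
    (varExp e n 0 + (varExp e n 4 + varExp e n (e - 2)))
    (varExp e n 2 + varExp e n (e - 2)) (varExp e n 4 + varExp e n (e - 2))
    ⟨2, ?_⟩ ⟨2, ?_⟩ ⟨1, ?_⟩ ⟨1, ?_⟩ (fun i j hi hij hj hin hjn => ?_)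
    (fun i hi hi1 hin => Or.inl (hsq i hi1 hin hi)) (fun i hi hi1 hin x hx => ?_)
  · rw [map_add, map_add, hw _ (by omega), hw _ (by omega), hw _ (by omega)]; omega
  · rw [map_add, map_add, hw _ (by omega), hw _ (by omega), hw _ (by omega)]; omega
  · rw [map_add, hw _ (by omega), hw _ (by omega)]; omega
  · rw [map_add, hw _ (by omega), hw _ (by omega)]; omega
  · rcases htwo i j hi hij hj hin hjn with h | ⟨rfl | rfl, rfl⟩
    · exact ⟨Or.inl h, Or.inl (h.of_add_eq rfl)⟩
    · exact ⟨Or.inr (by simp [IsNormalExp]), Or.inr (by simp [IsNormalExp])⟩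
    · exact ⟨Or.inr (by simp [IsNormalExp]), Or.inr (by simp [IsNormalExp])⟩
  · rcases Nat.eq_zero_or_pos i with rfl | hi0
    · have h := hsq (e - 2) (by omega) (by omega) le_rfl
      rcases hx with rfl | rfl | rfl | rfl
      · exact Or.inl (h.of_add_eq (c := varExp e n 2) (by abel))
      · exact Or.inl (h.of_add_eq (c := varExp e n 4) (by abel))
      · exact Or.inr (by simp [IsNormalExp])
      · exact Or.inr (by simp [IsNormalExp])
    · have h1 := hlast i 2 (by omega) hin hi (Or.inl rfl)
      have h2 := hlast i 4 (by omega) hin hi (Or.inr rfl)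
      rcases hx with rfl | rfl | rfl | rfl
      · exact Or.inl (h1.of_add_eq (c := varExp e n 0) (by abel))
      · exact Or.inl (h2.of_add_eq (c := varExp e n 0) (by abel))
      · exact Or.inl h1
      · exact Or.inl h2

theorem span_lmSet_eq_of_four_le (he : 10 ≤ e) (hn4 : 4 ≤ n) (hne : n ≤ e - 3) :
    Ideal.span (lmSet e 1 n (gbSet e n)) =
      Ideal.span (lmSet e 1 n (sallyIdeal e 1 n : Set (MvPolynomial (SallyIdx e 1 n) ℚ))) := by
  have hsq (i : ℕ) (hi1 : i ≠ 1) (hin : i ≠ n) (hie : i ≤ e - 2) :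
      IsReducible e n (varExp e n 0 + varExp e n 0 + varExp e n i) := by
    obtain rfl | rfl | hi : i = 0 ∨ i = n - 1 ∨ (2 ≤ i ∧ i ≠ n - 1) := by omega
    · exact isReducible_zero_cubed (by omega) (by omega)
    · exact isReducible_zero_zero_pred he hn4 hne
    · exact isReducible_zero_zero (by omega) (by omega) hi.1 hie hin hi.2
  have htwo (i j : ℕ) (hi : 2 ≤ i) (hij : i ≤ j) (hj : j ≤ e - 2) (hin : i ≠ n) (hjn : j ≠ n) :
      IsReducible e n (varExp e n i + varExp e n j) ∨
        i = 2 ∧ j = n - 2 ∨ i = 2 ∧ j = e - 2 ∨ i = n + 1 ∧ j = e - 2 := by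
    by_cases hs : i = 2 ∧ j = n - 2 ∨ i = 2 ∧ j = e - 2 ∨ i = n + 1 ∧ j = e - 2
    · exact Or.inr hs
    left
    obtain h | h | h | h : i = 2 ∨ i = n + 1 ∨ (3 ≤ i ∧ j = n - 1) ∨
      (3 ≤ i ∧ i ≠ n + 1 ∧ j ≠ n - 1) := by omega
    · exact h ▸ isReducible_two_add (by omega) (by omega) (by omega) hjn (by omega)
    · exact h ▸ isReducible_succ_add he hn4 hne (by omega) (by omega)
    · rw [h.2, add_comm]
      exact isReducible_pred_add he hn4 hne h.1 (by omega)
    · exact isReducible_minor (by omega) h.1 hij hj hin h.2.1 hjn h.2.2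
  have htwo' (i j : ℕ) (hi : 2 ≤ i) (hj : 2 ≤ j) (hie : i ≤ e - 2) (hje : j ≤ e - 2) (hin : i ≠ n)
      (hjn : j ≠ n) (h : ¬ (i = 2 ∧ j = n - 2 ∨ i = 2 ∧ j = e - 2 ∨ i = n + 1 ∧ j = e - 2))
      (h' : ¬ (j = 2 ∧ i = n - 2 ∨ j = 2 ∧ i = e - 2 ∨ j = n + 1 ∧ i = e - 2)) :
      IsReducible e n (varExp e n i + varExp e n j) := by
    rcases le_total i j with hij | hij
    · exact (htwo i j hi hij hje hin hjn).resolve_right h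
    · rw [add_comm]
      exact (htwo j i hj hij hie hjn hin).resolve_right h'
  have hb (i : ℕ) (hi1 : i ≠ 1) (hin : i ≠ n) (hie : i ≤ e - 2) :
      IsReducible e n (varExp e n i + (varExp e n 2 + varExp e n (n - 2))) := by
    obtain rfl | rfl | hi : i = 0 ∨ i = 2 ∨ 3 ≤ i := by omega
    · rw [← add_assoc]
      exact isReducible_zero_two_pred he hn4 hne
    · by_cases hn : n = 4
      · rw [← add_assoc, show n - 2 = 2 by omega]
        exact isReducible_two_cubed_of_eq_four he hn
      · exact (htwo' 2 2 le_rfl le_rfl hie hie hin hin (by omega) (by omega)).of_add_eq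
          (c := varExp e n (n - 2)) (by abel)
    · by_cases hn : n = 4
      · rw [show n - 2 = 2 by omega]
        by_cases hie' : i = e - 2
        · subst hie'
          exact (isReducible_two_two_of_eq_four he hn).of_add_eq (c := 0) (by abel)
        · exact (htwo' i 2 (by omega) le_rfl hie (by omega) hin (by omega) (by omega)
            (by omega)).of_add_eq (c := varExp e n 2) (by abel)
      · exact (htwo' i (n - 2) (by omega) (by omega) hie (by omega) hin (by omega) (by omega)
          (by omega)).of_add_eq (c := varExp e n 2) (by abel)
  have hc (i : ℕ) (hi : 2 ≤ i) (hin : i ≠ n) (hie : i ≤ e - 2) :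
      IsReducible e n (varExp e n i + (varExp e n 2 + varExp e n (e - 2))) := by
    obtain rfl | rfl | hi' : i = n - 2 ∨ i = e - 2 ∨ (i ≠ n - 2 ∧ i ≠ e - 2) := by omega
    · exact (hb (e - 2) (by omega) (by omega) le_rfl).of_add_eq (c := 0) (by abel)
    · by_cases hn : n = e - 3
      · exact (isReducible_two_sq_of_eq_sub_three he hn).of_add_eq (c := 0) (by abel)
      · exact (htwo' (e - 2) (e - 2) hi hi le_rfl le_rfl hin hin (by omega) (by omega)).of_add_eq
          (c := varExp e n 2) (by abel)
    · exact (htwo' i 2 hi le_rfl hie (by omega) hin (by omega) (by omega) (by omega)).of_add_eq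
        (c := varExp e n (e - 2)) (by abel)
  have hd (i : ℕ) (hi1 : i ≠ 1) (hin : i ≠ n) (hie : i ≤ e - 2) :
      IsReducible e n (varExp e n i + (varExp e n (n + 1) + varExp e n (e - 2))) := by
    obtain rfl | hi : i = 0 ∨ 2 ≤ i := by omega
    · rw [← add_assoc]
      exact isReducible_zero_succ he hn4 hne
    by_cases hn : n = e - 3
    · rw [show n + 1 = e - 2 by omega]
      obtain rfl | rfl | hi' : i = 2 ∨ i = e - 2 ∨ (i ≠ 2 ∧ i ≠ e - 2) := by omega
      · rw [← add_assoc]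
        exact isReducible_two_sq_of_eq_sub_three he hn
      · rw [← add_assoc]
        exact isReducible_cubed_of_eq_sub_three he hn
      · exact (htwo' i (e - 2) hi (by omega) hie le_rfl hin (by omega) (by omega)
          (by omega)).of_add_eq (c := varExp e n (e - 2)) (by abel)
    · by_cases hi' : i = e - 2
      · subst hi'
        exact (htwo' (e - 2) (e - 2) hi hi hie hie hin hin (by omega) (by omega)).of_add_eq
          (c := varExp e n (n + 1)) (by abel)
      · exact (htwo' i (n + 1) hi (by omega) hie (by omega) hin (by omega) (by omega)
          (by omega)).of_add_eq (c := varExp e n (e - 2)) (by abel)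
  have hw (i : ℕ) (hi : i < e ∧ i ≠ 1 ∧ i ≠ n) : expWeight e n (varExp e n i) = e + i :=
    expWeight_varExp hi.1 hi.2.1 hi.2.2
  refine span_lmSet_eq_of_isNormalExp he (by omega) (by omega)
    (varExp e n 0 + (varExp e n 2 + varExp e n (e - 2)))
    (varExp e n 2 + varExp e n (n - 2))
    (varExp e n 2 + varExp e n (e - 2)) (varExp e n (n + 1) + varExp e n (e - 2))
    ⟨2, ?_⟩ ⟨1, ?_⟩ ⟨1, ?_⟩ ⟨1, ?_⟩ (fun i j hi hij hj hin hjn => ?_)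
    (fun i hi hi1 hin => Or.inl (hsq i hi1 hin hi)) (fun i hi hi1 hin x hx => ?_)
  · rw [map_add, map_add, hw _ (by omega), hw _ (by omega), hw _ (by omega)]; omega
  · rw [map_add, hw _ (by omega), hw _ (by omega)]; omega
  · rw [map_add, hw _ (by omega), hw _ (by omega)]; omega
  · rw [map_add, hw _ (by omega), hw _ (by omega)]; omega
  · rcases htwo i j hi hij hj hin hjn with h | ⟨rfl, rfl⟩ | ⟨rfl, rfl⟩ | ⟨rfl, rfl⟩
    · exact ⟨Or.inl h, Or.inl (h.of_add_eq rfl)⟩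
    · exact ⟨Or.inr (by simp [IsNormalExp]), Or.inl (hb 0 (by omega) (by omega) (by omega))⟩
    · exact ⟨Or.inr (by simp [IsNormalExp]), Or.inr (by simp [IsNormalExp])⟩
    · exact ⟨Or.inr (by simp [IsNormalExp]), Or.inl (hd 0 (by omega) (by omega) (by omega))⟩
  · rcases hx with rfl | rfl | rfl | rfl
    · obtain rfl | hi2 : i = 0 ∨ 2 ≤ i := by omega
      · exact Or.inl ((hsq 2 (by omega) (by omega) (by omega)).of_add_eq
          (c := varExp e n (e - 2)) (by abel))
      · exact Or.inl ((hc i hi2 hin hi).of_add_eq (c := varExp e n 0) (by abel))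
    · exact Or.inl (hb i hi1 hin hi)
    · obtain rfl | hi2 : i = 0 ∨ 2 ≤ i := by omega
      · exact Or.inr (by simp [IsNormalExp])
      · exact Or.inl (hc i hi2 hin hi)
    · exact Or.inl (hd i hi1 hin hi)

theorem span_lmSet_eq_of_eq_sub_two (he : 10 ≤ e) (hn : n = e - 2) :
    Ideal.span (lmSet e 1 n (gbSet e n)) =
      Ideal.span (lmSet e 1 n (sallyIdeal e 1 n : Set (MvPolynomial (SallyIdx e 1 n) ℚ))) := by
  have hcube : IsReducible e n (varExp e n 0 + varExp e n 0 + varExp e n 0) :=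
    isReducible_zero_cubed_of_eq_sub_two he hn
  have hsq (i : ℕ) (hi : 2 ≤ i) (hie : i ≤ e - 4) :
      IsReducible e n (varExp e n 0 + varExp e n 0 + varExp e n i) :=
    isReducible_zero_zero (by omega) (by omega) hi (by omega) (by omega) (by omega)
  have hzero : IsReducible e n (varExp e n 0 + (varExp e n 2 + varExp e n (e - 4))) := by
    rw [← add_assoc]
    exact isReducible_zero_two_of_eq_sub_two he hn
  have htwo (i j : ℕ) (hi : 2 ≤ i) (hij : i ≤ j) (hj : j ≤ e - 3) :
      IsReducible e n (varExp e n i + varExp e n j) ∨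
        i = 2 ∧ j = e - 4 ∨ i = 3 ∧ j = e - 3 := by
    by_cases hs : i = 2 ∧ j = e - 4 ∨ i = 3 ∧ j = e - 3
    · exact Or.inr hs
    left
    obtain h | h | h : i = 2 ∨ (4 ≤ i ∧ j = e - 3) ∨ (3 ≤ i ∧ j ≠ e - 3) := by omega
    · exact h ▸ isReducible_two_add (by omega) (by omega) (by omega) (by omega) (by omega)
    · rw [h.2, add_comm]
      exact isReducible_pred_add_of_eq_sub_two he hn h.1 (by omega)
    · exact isReducible_minor (by omega) h.1 hij (by omega) (by omega) (by omega) (by omega)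
        (by omega)
  have hb (i : ℕ) (hi1 : i ≠ 1) (hie : i ≤ e - 3) :
      IsReducible e n (varExp e n i + (varExp e n 2 + varExp e n (e - 4))) := by
    obtain rfl | rfl | rfl | hi : i = 0 ∨ i = 2 ∨ i = e - 3 ∨ (3 ≤ i ∧ i ≤ e - 4) := by omega
    · exact hzero
    · exact ((htwo 2 2 le_rfl le_rfl hie).resolve_right (by omega)).of_add_eq
        (c := varExp e n (e - 4)) (by abel)
    · exact ((htwo (e - 4) (e - 3) (by omega) (by omega) le_rfl).resolve_right
        (by omega)).of_add_eq (c := varExp e n 2) (by abel)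
    · exact ((htwo i (e - 4) (by omega) hi.2 (by omega)).resolve_right (by omega)).of_add_eq
        (c := varExp e n 2) (by abel)
  have hc (i : ℕ) (hi : 2 ≤ i) (hie : i ≤ e - 3) :
      IsReducible e n (varExp e n i + (varExp e n 3 + varExp e n (e - 3))) := by
    by_cases hi4 : 4 ≤ i
    · exact ((htwo i (e - 3) hi hie le_rfl).resolve_right (by omega)).of_add_eq
        (c := varExp e n 3) (by abel)
    · exact ((htwo i 3 hi (by omega) (by omega)).resolve_right (by omega)).of_add_eq
        (c := varExp e n (e - 3)) (by abel)
  have hd (i : ℕ) (hi1 : i ≠ 1) (hie : i ≤ e - 3) :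
      IsReducible e n (varExp e n i + (varExp e n 0 + varExp e n 0 + varExp e n (e - 3))) := by
    obtain rfl | rfl | hi : i = 0 ∨ i = e - 3 ∨ (2 ≤ i ∧ i ≤ e - 4) := by omega
    · exact hcube.of_add_eq (c := varExp e n (e - 3)) (by abel)
    · exact ((htwo (e - 3) (e - 3) (by omega) le_rfl le_rfl).resolve_right (by omega)).of_add_eq
        (c := varExp e n 0 + varExp e n 0) (by abel)
    · exact (hsq i hi.1 hi.2).of_add_eq (c := varExp e n (e - 3)) (by abel)
  have hw (i : ℕ) (hi : i < e ∧ i ≠ 1 ∧ i ≠ n) : expWeight e n (varExp e n i) = e + i :=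
    expWeight_varExp hi.1 hi.2.1 hi.2.2
  refine span_lmSet_eq_of_isNormalExp he (by omega) (by omega)
    (varExp e n 0 + (varExp e n 3 + varExp e n (e - 3)))
    (varExp e n 2 + varExp e n (e - 4)) (varExp e n 3 + varExp e n (e - 3))
    (varExp e n 0 + varExp e n 0 + varExp e n (e - 3))
    ⟨2, ?_⟩ ⟨1, ?_⟩ ⟨1, ?_⟩ ⟨1, ?_⟩ (fun i j hi hij hj hin hjn => ?_) (fun i hi hi1 hin => ?_)
    (fun i hi hi1 hin x hx => ?_)
  · rw [map_add, map_add, hw _ (by omega), hw _ (by omega), hw _ (by omega)]; omega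
  · rw [map_add, hw _ (by omega), hw _ (by omega)]; omega
  · rw [map_add, hw _ (by omega), hw _ (by omega)]; omega
  · rw [map_add, map_add, hw _ (by omega), hw _ (by omega)]; omega
  · rcases htwo i j hi hij (by omega) with h | ⟨rfl, rfl⟩ | ⟨rfl, rfl⟩
    · exact ⟨Or.inl h, Or.inl (h.of_add_eq rfl)⟩
    · exact ⟨Or.inr (by simp [IsNormalExp]), Or.inl hzero⟩
    · exact ⟨Or.inr (by simp [IsNormalExp]), Or.inr (by simp [IsNormalExp])⟩
  · obtain rfl | rfl | hi' : i = 0 ∨ i = e - 3 ∨ (2 ≤ i ∧ i ≤ e - 4) := by omega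
    · exact Or.inl hcube
    · exact Or.inr (by simp [IsNormalExp])
    · exact Or.inl (hsq i hi'.1 hi'.2)
  · obtain rfl | hi2 : i = 0 ∨ 2 ≤ i := by omega
    · rcases hx with rfl | rfl | rfl | rfl
      · exact Or.inl ((hsq 3 (by omega) (by omega)).of_add_eq (c := varExp e n (e - 3)) (by abel))
      · exact Or.inl hzero
      · exact Or.inr (by simp [IsNormalExp])
      · exact Or.inl (hd 0 hi1 (by omega))
    · rcases hx with rfl | rfl | rfl | rfl
      · exact Or.inl ((hc i hi2 (by omega)).of_add_eq (c := varExp e n 0) (by abel))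
      · exact Or.inl (hb i hi1 (by omega))
      · exact Or.inl (hc i hi2 (by omega))
      · exact Or.inl (hd i hi1 (by omega))

end GroebnerCases

theorem stmt17 (e n : ℕ) (he : 10 ≤ e) (hn2 : 2 ≤ n) (hne : n ≤ e - 2) :
    Ideal.span (lmSet e 1 n (gbSet e n)) =
      Ideal.span (lmSet e 1 n (sallyIdeal e 1 n : Set (MvPolynomial (SallyIdx e 1 n) ℚ))) := by
  obtain hn | hn | ⟨hn, hn'⟩ | hn : n = 2 ∨ n = 3 ∨ (4 ≤ n ∧ n ≤ e - 3) ∨ n = e - 2 := by omega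
  · exact span_lmSet_eq_of_eq_two he hn
  · exact span_lmSet_eq_of_eq_three he hn
  · exact span_lmSet_eq_of_four_le he hn hn'
  · exact span_lmSet_eq_of_eq_sub_two he hn
end

section
/- Let e ≥ 10 and consider (m,n) = (e−4, e−3), with R(e,e−4,e−3) equipped with the graded reverse lexicographic order in which x_i > x_j whenever i < j. Then: (1) the binomial x_0^2 x_{e−5} x_{e−1} − x_{e−2}^3 belongs to I_{S(e,e−4,e−3)}, and x_0^2 x_{e−5} x_{e−1} is its leading monomial; (2) the monomial x_0^2 x_{e−5} is NOT the leading monomial of any nonzero element of I_{S(e,e−4,e−3)}; equivalently, x_0^2 x_{e−5} does not belong to the initial ideal of I_{S(e,e−4,e−3)}, i.e., to the ideal generated by the leading monomials of all nonzero elements of I_{S(e,e−4,e−3)}. -/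
open MvPolynomial

/-- The sum of the indices of a monomial, counted with multiplicity. -/
noncomputable def indexWeight (e m n : ℕ) : (SallyIdx e m n →₀ ℕ) →+ ℕ :=
  Finsupp.weight (fun i : SallyIdx e m n => i.1)

theorem indexWeight_single {e m n : ℕ} (i : SallyIdx e m n) (k : ℕ) :
    indexWeight e m n (Finsupp.single i k) = k * i.1 := by
  simp [indexWeight, Finsupp.weight_single]

theorem aeval_monomial_sally {e m n : ℕ} (d : SallyIdx e m n →₀ ℕ) (c : ℚ) :
    MvPolynomial.aeval (fun i : SallyIdx e m n => (Polynomial.X : Polynomial ℚ) ^ (e + i.1))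
      (monomial d c) = Polynomial.monomial (e * d.degree + indexWeight e m n d) c := by
  rw [MvPolynomial.aeval_monomial, ← Polynomial.C_mul_X_pow_eq_monomial]
  congr 1
  induction d using Finsupp.induction_linear with
  | zero => simp
  | add f g hf hg =>
    rw [Finsupp.prod_add_index' (by simp) (by intros; rw [pow_add]), hf, hg, ← pow_add, map_add,
      map_add]
    ring
  | single i k =>
    rw [Finsupp.prod_single_index (by simp), indexWeight_single, Finsupp.degree_single, ← pow_mul]
    ring

theorem exists_ne_mem_support {e m n : ℕ} {p : MvPolynomial (SallyIdx e m n) ℚ}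
    (hp : p ∈ sallyIdeal e m n) {d : SallyIdx e m n →₀ ℕ} (hd : d ∈ p.support) :
    ∃ d' ∈ p.support, d' ≠ d ∧
      e * d'.degree + indexWeight e m n d' = e * d.degree + indexWeight e m n d := by
  by_contra! h
  have h0 : MvPolynomial.aeval
      (fun i : SallyIdx e m n => (Polynomial.X : Polynomial ℚ) ^ (e + i.1)) p = 0 := hp
  rw [p.as_sum, map_sum] at h0
  simp only [aeval_monomial_sally] at h0
  have h1 := congrArg (fun q => q.coeff (e * d.degree + indexWeight e m n d)) h0
  simp only [Polynomial.finsetSum_coeff, Polynomial.coeff_monomial, Polynomial.coeff_zero] at h1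
  rw [Finset.sum_eq_single_of_mem d hd fun b hb hbd => if_neg (h b hb hbd), if_pos rfl] at h1
  exact MvPolynomial.mem_support_iff.mp hd h1

theorem exists_eq_single_add {σ : Type*} {d : σ →₀ ℕ} (hd : d ≠ 0) :
    ∃ i d', d = Finsupp.single i 1 + d' := by
  obtain ⟨i, hi⟩ := Finsupp.ne_iff.mp hd
  refine ⟨i, le_iff_exists_add.mp ?_⟩
  simpa [Finsupp.single_le_iff, Nat.one_le_iff_ne_zero] using hi

theorem indexWeight_mono {e m n : ℕ} {a b : SallyIdx e m n →₀ ℕ} (h : a ≤ b) :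
    indexWeight e m n a ≤ indexWeight e m n b := by
  obtain ⟨c, rfl⟩ := le_iff_exists_add.mp h
  simp

theorem indexWeight_le {e m n : ℕ} (d : SallyIdx e m n →₀ ℕ) :
    indexWeight e m n d ≤ (e - 1) * d.degree := by
  induction d using Finsupp.induction_linear with
  | zero => simp
  | add f g hf hg => rw [map_add, map_add, mul_add]; exact add_le_add hf hg
  | single i k =>
    rw [indexWeight_single, Finsupp.degree_single, mul_comm]
    exact Nat.mul_le_mul_right k (by have := i.2; omega)

/-- No monomial of degree two has index sum `2 * e - 5`, as both `(e - 4) + (e - 1)` and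
`(e - 3) + (e - 2)` involve a missing index. -/
theorem indexWeight_ne_of_degree_eq_two {e : ℕ} (he : 10 ≤ e)
    {d : SallyIdx e (e - 4) (e - 3) →₀ ℕ} (hd : d.degree = 2) :
    indexWeight e (e - 4) (e - 3) d ≠ 2 * e - 5 := by
  obtain ⟨i, d₁, rfl⟩ := exists_eq_single_add (d := d) (by rintro rfl; simp at hd)
  rw [map_add, Finsupp.degree_single] at hd
  obtain ⟨j, d₂, rfl⟩ := exists_eq_single_add (d := d₁) (by rintro rfl; simp at hd)
  rw [map_add, Finsupp.degree_single] at hd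
  obtain rfl := (Finsupp.degree_eq_zero_iff d₂).mp (by omega)
  have hi := i.2
  have hj := j.2
  simp only [map_add, indexWeight_single, map_zero]
  omega

theorem not_grevlexLT_of_weight_eq {e : ℕ} (he : 10 ≤ e) {z f : SallyIdx e (e - 4) (e - 3)}
    (hz : z.1 = 0) (hf : f.1 = e - 5) {a b : ℕ} (ha : a ≤ 2) (hb : b ≤ 1)
    {d' : SallyIdx e (e - 4) (e - 3) →₀ ℕ}
    (hw : e * d'.degree + indexWeight e (e - 4) (e - 3) d' =
      e * (a + b) + b * (e - 5)) :
    ¬ grevlexLT e (e - 4) (e - 3) d' (Finsupp.single z a + Finsupp.single f b) := by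
  have hzf : z ≠ f := fun h => by have := congrArg Subtype.val h; omega
  have hdeg : (Finsupp.single z a + Finsupp.single f b).degree = a + b := by simp
  have hle := indexWeight_le d'
  rintro (h | ⟨h, k, hk, hkj⟩)
  · change d'.degree < (Finsupp.single z a + Finsupp.single f b).degree at h
    rw [hdeg] at h
    have h2 := fun h => indexWeight_ne_of_degree_eq_two he (d := d') h
    generalize d'.degree = t at *
    generalize indexWeight e (e - 4) (e - 3) d' = s at *
    have ht : t ≤ 2 := by omega
    interval_cases t <;> interval_cases a <;> interval_cases b <;> omega
  · change d'.degree = (Finsupp.single z a + Finsupp.single f b).degree at h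
    rw [hdeg] at h
    rw [h] at hw
    have hs : indexWeight e (e - 4) (e - 3) d' = b * (e - 5) := by omega
    have hkw : d' k * k.1 ≤ b * (e - 5) := by
      rw [← hs, ← indexWeight_single]
      exact indexWeight_mono (Finsupp.single_le_iff.mpr le_rfl)
    have hk0 : 1 ≤ d' k := by omega
    have hkle : k.1 ≤ d' k * k.1 := Nat.le_mul_of_pos_left _ hk0
    rcases lt_trichotomy k.1 (e - 5) with hlt | heq | hgt
    · have hkf : k ≠ f := fun h => by have := congrArg Subtype.val h; omega
      have hfb : d' f = b := by
        rw [hkj f (by omega)]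
        simp [hzf]
      have hle2 : Finsupp.single k (d' k) + Finsupp.single f b ≤ d' := by
        intro j
        by_cases hjk : j = k
        · subst hjk; simp [hkf]
        · by_cases hjf : j = f
          · subst hjf; simp [hjk, hfb]
          · simp [hjk, hjf]
      have hw2 := indexWeight_mono hle2
      rw [map_add, indexWeight_single, indexWeight_single, hf, hs] at hw2
      have hkz : k = z := Subtype.ext (by omega)
      subst hkz
      obtain ⟨c, hc⟩ := le_iff_exists_add.mp hle2
      have hd := congrArg Finsupp.degree hc
      simp only [map_add, Finsupp.degree_single] at hd
      simp [hkf] at hk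
      omega
    · have hkf : k = f := Subtype.ext (by omega)
      subst hkf
      simp [hzf.symm] at hk
      have := Nat.mul_le_mul_right (e - 5) hk
      rw [heq] at hkw
      rw [Nat.succ_mul] at this
      omega
    · have := Nat.mul_le_mul_right (e - 5) hb
      omega

theorem not_isLeadExp_of_mem_sallyIdeal {e : ℕ} (he : 10 ≤ e) {z f : SallyIdx e (e - 4) (e - 3)}
    (hz : z.1 = 0) (hf : f.1 = e - 5) {p : MvPolynomial (SallyIdx e (e - 4) (e - 3)) ℚ}
    (hp : p ∈ sallyIdeal e (e - 4) (e - 3)) {d : SallyIdx e (e - 4) (e - 3) →₀ ℕ}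
    (hd : d ≤ Finsupp.single z 2 + Finsupp.single f 1) :
    ¬ IsLeadExp e (e - 4) (e - 3) p d := by
  rintro ⟨hmem, hlead⟩
  have hzf : z ≠ f := fun h => by have := congrArg Subtype.val h; omega
  have hdz : d z ≤ 2 := by simpa [hzf, hzf.symm] using hd z
  have hdf : d f ≤ 1 := by simpa [hzf, hzf.symm] using hd f
  have hd_eq : d = Finsupp.single z (d z) + Finsupp.single f (d f) := by
    ext j
    by_cases hjz : j = z
    · subst hjz; simp [hzf.symm]
    · by_cases hjf : j = f
      · subst hjf; simp [hzf]
      · simpa [Ne.symm hjz, Ne.symm hjf, hjz, hjf] using hd j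
  obtain ⟨d', hd', hne, hw⟩ := exists_ne_mem_support hp hmem
  have hlt := hlead d' hd' hne
  generalize d z = a at *
  generalize d f = b at *
  subst hd_eq
  refine not_grevlexLT_of_weight_eq he hz hf hdz hdf ?_ hlt
  rw [hw]
  simp [indexWeight_single, hz, hf]

theorem stmt18 (e : ℕ) (he : 10 ≤ e) :
    -- (1) the binomial lies in the ideal and `x_0² x_{e−5} x_{e−1}` is its leading monomial
    ((sX e (e-4) (e-3) 0 ^ 2 * sX e (e-4) (e-3) (e-5) * sX e (e-4) (e-3) (e-1) -
        sX e (e-4) (e-3) (e-2) ^ 3 ∈ sallyIdeal e (e-4) (e-3)) ∧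
      ∃ d : SallyIdx e (e-4) (e-3) →₀ ℕ,
        sX e (e-4) (e-3) 0 ^ 2 * sX e (e-4) (e-3) (e-5) * sX e (e-4) (e-3) (e-1) =
          MvPolynomial.monomial d (1 : ℚ) ∧
        IsLeadExp e (e-4) (e-3)
          (sX e (e-4) (e-3) 0 ^ 2 * sX e (e-4) (e-3) (e-5) * sX e (e-4) (e-3) (e-1) -
            sX e (e-4) (e-3) (e-2) ^ 3) d) ∧
    -- (2) `x_0² x_{e−5}` is not the leading monomial of any nonzero element of the ideal
    (¬ ∃ p ∈ sallyIdeal e (e-4) (e-3), p ≠ 0 ∧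
        ∃ d : SallyIdx e (e-4) (e-3) →₀ ℕ,
          sX e (e-4) (e-3) 0 ^ 2 * sX e (e-4) (e-3) (e-5) = MvPolynomial.monomial d (1 : ℚ) ∧
          IsLeadExp e (e-4) (e-3) p d) ∧
    -- equivalently, it does not belong to the initial ideal
    sX e (e-4) (e-3) 0 ^ 2 * sX e (e-4) (e-3) (e-5) ∉
      Ideal.span (lmSet e (e-4) (e-3)
        (sallyIdeal e (e-4) (e-3) : Set (MvPolynomial (SallyIdx e (e-4) (e-3)) ℚ))) := by
  have h0 : 0 < e ∧ 0 ≠ e - 4 ∧ 0 ≠ e - 3 := by omega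
  have h5 : e - 5 < e ∧ e - 5 ≠ e - 4 ∧ e - 5 ≠ e - 3 := by omega
  have h1 : e - 1 < e ∧ e - 1 ≠ e - 4 ∧ e - 1 ≠ e - 3 := by omega
  have h2 : e - 2 < e ∧ e - 2 ≠ e - 4 ∧ e - 2 ≠ e - 3 := by omega
  simp only [sX, dif_pos h0, dif_pos h5, dif_pos h1, dif_pos h2]
  set z : SallyIdx e (e - 4) (e - 3) := ⟨0, h0⟩ with hz
  set f : SallyIdx e (e - 4) (e - 3) := ⟨e - 5, h5⟩ with hf
  set u : SallyIdx e (e - 4) (e - 3) := ⟨e - 1, h1⟩ with hu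
  set v : SallyIdx e (e - 4) (e - 3) := ⟨e - 2, h2⟩ with hv
  have hmon : (X z ^ 2 * X f : MvPolynomial (SallyIdx e (e - 4) (e - 3)) ℚ) =
      monomial (Finsupp.single z 2 + Finsupp.single f 1) 1 := by
    rw [X_pow_eq_monomial, X, monomial_mul, mul_one]
  have hmon' : (X z ^ 2 * X f * X u : MvPolynomial (SallyIdx e (e - 4) (e - 3)) ℚ) =
      monomial (Finsupp.single z 2 + Finsupp.single f 1 + Finsupp.single u 1) 1 := by
    rw [hmon, X, monomial_mul, mul_one]
  refine ⟨⟨?_, _, hmon', ?_⟩, ?_, ?_⟩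
  · change MvPolynomial.aeval
      (fun i : SallyIdx e (e - 4) (e - 3) => (Polynomial.X : Polynomial ℚ) ^ (e + i.1)) _ = 0
    simp only [map_sub, map_mul, map_pow, aeval_X, ← pow_mul, ← pow_add, hz, hf, hu, hv]
    rw [sub_eq_zero]
    congr 1
    omega
  · have hlt : (Finsupp.single v 3).degree <
        (Finsupp.single z 2 + Finsupp.single f 1 + Finsupp.single u 1).degree := by
      simp
    have hne : Finsupp.single v 3 ≠
        Finsupp.single z 2 + Finsupp.single f 1 + Finsupp.single u 1 :=
      fun h => hlt.ne (congrArg Finsupp.degree h)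
    rw [hmon', X_pow_eq_monomial]
    refine ⟨?_, fun d' hd' hd'ne => ?_⟩
    · rw [mem_support_iff, coeff_sub, coeff_monomial, coeff_monomial, if_pos rfl, if_neg hne]
      norm_num
    · rw [mem_support_iff, coeff_sub, coeff_monomial, coeff_monomial, if_neg hd'ne.symm] at hd'
      obtain rfl : Finsupp.single v 3 = d' := by
        by_contra h
        simp [h] at hd'
      exact Or.inl hlt
  · rintro ⟨p, hp, -, d, hd, hlead⟩
    rw [hmon] at hd
    have hd' := monomial_left_injective (one_ne_zero (α := ℚ)) hd
    exact not_isLeadExp_of_mem_sallyIdeal he rfl rfl hp hd'.ge hlead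
  · have himage : lmSet e (e - 4) (e - 3) (sallyIdeal e (e - 4) (e - 3)) =
        (fun d => monomial d (1 : ℚ)) ''
          {d | ∃ p ∈ sallyIdeal e (e - 4) (e - 3), IsLeadExp e (e - 4) (e - 3) p d} := by
      ext q
      constructor
      · rintro ⟨p, hp, -, d, hd, rfl⟩
        exact ⟨d, ⟨p, hp, hd⟩, rfl⟩
      · rintro ⟨d, ⟨p, hp, hd⟩, rfl⟩
        exact ⟨p, hp, support_nonempty.mp ⟨d, hd.1⟩, d, hd, rfl⟩
    rw [himage, mem_ideal_span_monomial_image, hmon]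
    intro h
    obtain ⟨d, ⟨p, hp, hd⟩, hle⟩ := h (Finsupp.single z 2 + Finsupp.single f 1) (by
      rw [mem_support_iff, coeff_monomial, if_pos rfl]
      exact one_ne_zero)
    exact not_isLeadExp_of_mem_sallyIdeal he (z := z) (f := f) rfl rfl hp hle hd
end
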